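/- arXiv:2109.10747 — 6 statements merged into one kernel-verified Lean document; each statement's English description precedes it below -/
import Mathlib

section
/- Given an open set Ω ⊂ ℝ^d, let Q be a dyadically complete set of cubes Q with Q ⊂ Ω, and let f ∈ L^1_loc(Ω) with var_Ω f < ∞. Define M_Q f(x) = max{ f(x), sup{ f_Q : Q ∈ Q, x ∈ Q } } and M̄_Q f(x) = max{ f(x), sup{ f_Q : Q ∈ Q, x ∈ closure(Q) } }. Then M̄_Q f(x) = M_Q f(x) for Lebesgue-almost every x ∈ Ω. -/
open MeasureTheory Metric Set Filter
open scoped ENNReal NNReal Topology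

noncomputable section

/-- Euclidean space `ℝ^d`. -/
abbrev Euc (d : ℕ) := EuclideanSpace ℝ (Fin d)

/-- The divergence of a vector field `φ : ℝ^d → ℝ^d`. -/
def diverg (d : ℕ) (φ : Euc d → Euc d) (x : Euc d) : ℝ :=
  ∑ i : Fin d, fderiv ℝ φ x (EuclideanSpace.single i 1) i

/-- The variation of `f` on an open set `Ω`:
`var_Ω f = sup { ∫_Ω f div φ : φ ∈ C_c^1(Ω; ℝ^d), |φ| ≤ 1 }`. -/
def variation (d : ℕ) (Ω : Set (Euc d)) (f : Euc d → ℝ) : ℝ≥0∞ :=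
  ⨆ (φ : Euc d → Euc d) (_ : ContDiff ℝ 1 φ) (_ : HasCompactSupport φ)
    (_ : tsupport φ ⊆ Ω) (_ : ∀ x, ‖φ x‖ ≤ 1),
    ENNReal.ofReal (∫ x in Ω, f x * diverg d φ x)

/-- `Q` is a cube of side length `l`: the image of `(0,1)^d` scaled by `l`,
rotated and translated. -/
def IsCubeOfSide (d : ℕ) (l : ℝ) (Q : Set (Euc d)) : Prop :=
  0 < l ∧ ∃ (r : Euc d ≃ₗᵢ[ℝ] Euc d) (v : Euc d),
    Q = (fun x => l • r x + v) '' {x : Euc d | ∀ i, x i ∈ Set.Ioo (0:ℝ) 1}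

/-- `Q` is a cube (of some positive side length, arbitrary orientation). -/
def IsCube (d : ℕ) (Q : Set (Euc d)) : Prop := ∃ l, IsCubeOfSide d l Q

/-- The side length of a cube, recovered from its volume. -/
def sideLength (d : ℕ) (Q : Set (Euc d)) : ℝ := (volume Q).toReal ^ ((d:ℝ)⁻¹)

/-- The center of a cube, recovered as its barycenter. -/
def cubeCenter (d : ℕ) (Q : Set (Euc d)) : Euc d := (volume Q).toReal⁻¹ • ∫ x in Q, x

/-- The dilate `KQ = {c_Q + K r : c_Q + r ∈ Q}` of a cube `Q` about its center. -/
def dilate (d : ℕ) (K : ℝ) (Q : Set (Euc d)) : Set (Euc d) :=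
  {y | ∃ x ∈ Q, y = cubeCenter d Q + K • (x - cubeCenter d Q)}

/-- `Q ∈ Δ(Q0)`: `Q` is a dyadic subcube of the cube `Q0`, i.e. the image under the
affine bijection mapping `(0,1)^d` onto `Q0` of a dyadic subcube of `(0,1)^d`. -/
def IsDyadicOf (d : ℕ) (Q Q0 : Set (Euc d)) : Prop :=
  ∃ (l : ℝ) (r : Euc d ≃ₗᵢ[ℝ] Euc d) (v : Euc d), 0 < l ∧
    Q0 = (fun x => l • r x + v) '' {x : Euc d | ∀ i, x i ∈ Set.Ioo (0:ℝ) 1} ∧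
    ∃ (n : ℕ) (k : Fin d → ℕ), (∀ i, k i < 2 ^ n) ∧
      Q = (fun x => l • r x + v) ''
        {x : Euc d | ∀ i, x i ∈ Set.Ioo ((k i : ℝ) / 2 ^ n) (((k i : ℝ) + 1) / 2 ^ n)}

/-- A set of cubes is dyadically complete if for all `Q0, P` in it with `P ⊆ Q0`,
every dyadic cube `Q ∈ Δ(Q0)` with `P ⊆ Q` also belongs to it. -/
def DyadicComplete (d : ℕ) (𝒬 : Set (Set (Euc d))) : Prop :=
  ∀ Q0 ∈ 𝒬, ∀ P ∈ 𝒬, P ⊆ Q0 → ∀ Q, IsDyadicOf d Q Q0 → P ⊆ Q → Q ∈ 𝒬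

/-- The measure theoretic closure `cl* E = {x : limsup_{r→0} |B(x,r)∩E|/r^d > 0}`. -/
def mClosure (d : ℕ) (E : Set (Euc d)) : Set (Euc d) :=
  {x | 0 < Filter.limsup (fun r : ℝ => volume (Metric.ball x r ∩ E) / ENNReal.ofReal (r ^ d))
      (nhdsWithin 0 (Set.Ioi 0))}

/-- The measure theoretic boundary `∂* E = cl* E ∩ cl* (Eᶜ)`. -/
def mBoundary (d : ℕ) (E : Set (Euc d)) : Set (Euc d) := mClosure d E ∩ mClosure d Eᶜ

/-- `E` has locally finite perimeter: the variation of its indicator function is finite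
on every bounded open set. -/
def HasLocallyFinitePerimeter (d : ℕ) (E : Set (Euc d)) : Prop :=
  ∀ V : Set (Euc d), IsOpen V → Bornology.IsBounded V →
    variation d V (Set.indicator E fun _ => (1:ℝ)) < ⊤

/-- The integral average `f_Q = |Q|⁻¹ ∫_Q f`. -/
def avg (d : ℕ) (f : Euc d → ℝ) (Q : Set (Euc d)) : ℝ :=
  (volume Q).toReal⁻¹ * ∫ x in Q, f x

/-- The maximal function `M_𝒬 f (x) = max { f(x), sup { f_Q : Q ∈ 𝒬, x ∈ Q } }`. -/
def maximalOver (d : ℕ) (𝒬 : Set (Set (Euc d))) (f : Euc d → ℝ) (x : Euc d) : ℝ :=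
  max (f x) (sSup {r | ∃ Q ∈ 𝒬, x ∈ Q ∧ r = avg d f Q})

/-- The maximal function `M̄_𝒬 f (x) = max { f(x), sup { f_Q : Q ∈ 𝒬, x ∈ closure Q } }`. -/
def maximalOverClosed (d : ℕ) (𝒬 : Set (Set (Euc d))) (f : Euc d → ℝ) (x : Euc d) : ℝ :=
  max (f x) (sSup {r | ∃ Q ∈ 𝒬, x ∈ closure Q ∧ r = avg d f Q})

/-- A family of convex open sets covers, up to a null set, the union of its closures. -/
theorem ae_mem_sUnion_of_mem_closure {E : Type*} [NormedAddCommGroup E] [NormedSpace ℝ E]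
    [FiniteDimensional ℝ E] [MeasurableSpace E] [BorelSpace E] (μ : Measure E)
    [μ.IsAddHaarMeasure] (𝒞 : Set (Set E)) (ho : ∀ C ∈ 𝒞, IsOpen C)
    (hc : ∀ C ∈ 𝒞, Convex ℝ C) :
    ∀ᵐ x ∂μ, ∀ C ∈ 𝒞, x ∈ closure C → x ∈ ⋃₀ 𝒞 := by
  have hU : IsOpen (⋃₀ 𝒞) := isOpen_sUnion ho
  have hdens := ae_all_iff.2 fun K : ℕ =>
    IsUnifLocDoublingMeasure.ae_tendsto_measure_inter_div μ (⋃₀ 𝒞)ᶜ (K : ℝ)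
  rw [ae_restrict_iff' hU.measurableSet.compl] at hdens
  filter_upwards [hdens] with x hx C hC hxC
  by_contra hxU
  obtain ⟨z, hz⟩ : C.Nonempty := closure_nonempty_iff.1 ⟨x, hxC⟩
  obtain ⟨ρ, hρ, hball⟩ := Metric.nhds_basis_closedBall.mem_iff.1 ((ho C hC).mem_nhds hz)
  obtain ⟨K, hK⟩ := exists_nat_ge (‖z - x‖ / ρ)
  rw [div_le_iff₀ hρ] at hK
  have hpos : ∀ᶠ t : ℝ in 𝓝[>] 0, 0 < t := eventually_mem_nhdsWithin
  have hle : ∀ᶠ t : ℝ in 𝓝[>] 0, t ≤ 1 :=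
    eventually_nhdsWithin_of_eventually_nhds (Iic_mem_nhds zero_lt_one)
  have hδ : Tendsto (fun t : ℝ => t * ρ) (𝓝[>] 0) (𝓝[>] 0) := by
    refine tendsto_nhdsWithin_iff.2 ⟨?_, hpos.mono fun t ht => mul_pos ht hρ⟩
    have : Tendsto (fun t : ℝ => t * ρ) (𝓝 0) (𝓝 (0 * ρ)) :=
      (continuous_id.mul continuous_const).tendsto 0
    rw [zero_mul] at this
    exact this.mono_left nhdsWithin_le_nhds
  have hone := hx hxU K (fun t : ℝ => x + t • (z - x)) (fun t => t * ρ) hδ (by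
    filter_upwards [hpos] with t ht
    rw [mem_closedBall, dist_eq_norm, sub_add_cancel_left, norm_neg, norm_smul,
      Real.norm_of_nonneg ht.le]
    calc t * ‖z - x‖ ≤ t * (K * ρ) := by gcongr
      _ = K * (t * ρ) := by ring)
  have hzero : ∀ᶠ t : ℝ in 𝓝[>] 0,
      μ ((⋃₀ 𝒞)ᶜ ∩ closedBall (x + t • (z - x)) (t * ρ)) /
        μ (closedBall (x + t • (z - x)) (t * ρ)) = 0 := by
    filter_upwards [hpos, hle] with t ht ht1
    have hsub : closedBall (x + t • (z - x)) (t * ρ) ⊆ C := by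
      intro y hy
      have hu : x + t⁻¹ • (y - x) ∈ C := by
        apply hball
        rw [mem_closedBall, dist_eq_norm] at hy ⊢
        have h : x + t⁻¹ • (y - x) - z = t⁻¹ • (y - (x + t • (z - x))) := by
          rw [← sub_sub y, smul_sub _ (y - x), inv_smul_smul₀ ht.ne']
          abel
        rw [h, norm_smul, norm_inv, Real.norm_of_nonneg ht.le, inv_mul_le_iff₀ ht]
        exact hy
      have h := (hc C hC).combo_closure_interior_mem_interior hxC
        ((ho C hC).interior_eq.symm ▸ hu) (sub_nonneg.2 ht1) ht (sub_add_cancel 1 t)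
      rw [(ho C hC).interior_eq] at h
      convert h using 1
      rw [smul_add, smul_inv_smul₀ ht.ne', sub_smul, one_smul]
      abel
    have hempty : (⋃₀ 𝒞)ᶜ ∩ closedBall (x + t • (z - x)) (t * ρ) = ∅ :=
      disjoint_iff_inter_eq_empty.1 <| disjoint_compl_left_iff_subset.2 <|
        hsub.trans (subset_sUnion_of_mem hC)
    rw [hempty, measure_empty, ENNReal.zero_div]
  exact zero_ne_one (tendsto_nhds_unique (tendsto_const_nhds.congr'
    (hzero.mono fun t ht => ht.symm)) hone)

theorem IsCube.isOpen {d : ℕ} {Q : Set (Euc d)} (hQ : IsCube d Q) : IsOpen Q := by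
  obtain ⟨l, hl, r, v, rfl⟩ := hQ
  have hmap : IsOpenMap fun x : Euc d => l • r x + v :=
    (isOpenMap_add_right v).comp ((isOpenMap_smul₀ hl.ne').comp r.toHomeomorph.isOpenMap)
  refine hmap _ ?_
  simp only [ofPred_forall]
  exact isOpen_iInter_of_finite fun i =>
    isOpen_Ioo.preimage (EuclideanSpace.proj (𝕜 := ℝ) i).continuous

theorem IsCube.convex {d : ℕ} {Q : Set (Euc d)} (hQ : IsCube d Q) : Convex ℝ Q := by
  obtain ⟨l, hl, r, v, rfl⟩ := hQ
  have hunit : Convex ℝ {x : Euc d | ∀ i, x i ∈ Set.Ioo (0:ℝ) 1} := by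
    simp only [ofPred_forall]
    exact convex_iInter fun i =>
      (convex_Ioo (0:ℝ) 1).linear_preimage (EuclideanSpace.proj (𝕜 := ℝ) i).toLinearMap
  have h := ((hunit.linear_image r.toLinearEquiv.toLinearMap).smul l).translate v
  rw [← image_smul, image_image, image_image] at h
  have heq : (fun x : Euc d => l • r x + v) = fun x => v + l • r x :=
    funext fun x => add_comm _ _
  rw [heq]
  exact h

/-- The supremum of a set of reals only depends on which rationals its elements exceed,
also for empty or unbounded sets. -/
theorem Real.sSup_congr_of_rat {s t : Set ℝ}
    (h : ∀ q : ℚ, (∃ a ∈ s, (q : ℝ) < a) ↔ ∃ a ∈ t, (q : ℝ) < a) : sSup s = sSup t := by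
  have key : ∀ {s t : Set ℝ}, (∀ q : ℚ, (∃ a ∈ s, (q : ℝ) < a) → ∃ a ∈ t, (q : ℝ) < a) →
      (s.Nonempty → t.Nonempty) ∧ upperBounds t ⊆ upperBounds s := by
    refine fun h => ⟨fun ⟨a, ha⟩ => ?_, fun b hb a ha => ?_⟩
    · obtain ⟨q, hq⟩ := exists_rat_lt a
      obtain ⟨c, hc, -⟩ := h q ⟨a, ha, hq⟩
      exact ⟨c, hc⟩
    · by_contra! hab
      obtain ⟨q, hbq, hqa⟩ := exists_rat_btwn hab
      obtain ⟨c, hc, hqc⟩ := h q ⟨a, ha, hqa⟩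
      exact absurd (hb hc) (hbq.trans hqc).not_ge
  obtain ⟨hne, hts⟩ := key fun q => (h q).1
  obtain ⟨hne', hst⟩ := key fun q => (h q).2
  have hub : upperBounds s = upperBounds t := hst.antisymm hts
  rcases s.eq_empty_or_nonempty with rfl | hs
  · rw [Set.not_nonempty_iff_eq_empty.1 fun ht => not_nonempty_empty (hne' ht)]
  by_cases hb : BddAbove s
  · have hlub : IsLUB t (sSup s) := by
      rw [IsLUB, ← hub]
      exact isLUB_csSup hs hb
    exact (hlub.csSup_eq (hne hs)).symm
  · have hb' : ¬BddAbove t := by rwa [BddAbove, ← hub]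
    rw [Real.sSup_of_not_bddAbove hb, Real.sSup_of_not_bddAbove hb']

/-- for an open `Ω`, a dyadically complete set `𝒬` of cubes contained in `Ω`
and `f ∈ L¹_loc(Ω)` with `var_Ω f < ∞`, we have `M̄_𝒬 f = M_𝒬 f` a.e. on `Ω`. -/
theorem stmt4 (d : ℕ) (hd : 1 ≤ d)
    (Ω : Set (Euc d)) (hΩ : IsOpen Ω)
    (𝒬 : Set (Set (Euc d))) (h𝒬 : ∀ Q ∈ 𝒬, IsCube d Q ∧ Q ⊆ Ω)
    (hdc : DyadicComplete d 𝒬)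
    (f : Euc d → ℝ) (hf : LocallyIntegrableOn f Ω volume)
    (hvar : variation d Ω f < ⊤) :
    ∀ᵐ x ∂(volume : Measure (Euc d)), x ∈ Ω →
      maximalOverClosed d 𝒬 f x = maximalOver d 𝒬 f x := by
  have hnull := ae_all_iff.2 fun q : ℚ =>
    ae_mem_sUnion_of_mem_closure (volume : Measure (Euc d)) {Q | Q ∈ 𝒬 ∧ (q : ℝ) < avg d f Q}
      (fun Q hQ => (h𝒬 Q hQ.1).1.isOpen) (fun Q hQ => (h𝒬 Q hQ.1).1.convex)
  filter_upwards [hnull] with x hx _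
  refine congrArg (max (f x)) (Real.sSup_congr_of_rat fun q => ⟨?_, ?_⟩)
  · rintro ⟨_, ⟨Q, hQ, hxQ, rfl⟩, hq⟩
    obtain ⟨P, ⟨hP, hqP⟩, hxP⟩ := hx q Q ⟨hQ, hq⟩ hxQ
    exact ⟨_, ⟨P, hP, hxP, rfl⟩, hqP⟩
  · rintro ⟨a, ⟨Q, hQ, hxQ, ha⟩, hq⟩
    exact ⟨a, ⟨Q, hQ, subset_closure hxQ, ha⟩, hq⟩
end
end

section
/- Let Q ⊂ ℝ^d be a cube centered in the origin and let x ∈ ∂Q be a point of a face of Q with outer unit normal vector e. Then ∠(x, e) ≤ π/2 − arcsin(1/√d). -/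
open MeasureTheory Metric Set Filter
open scoped ENNReal NNReal Topology

noncomputable section

/-- if `Q = {l • r y + v : y ∈ (0,1)^d}` is a cube centered at the origin
(i.e. the image of the center `c = (1/2,…,1/2)` is `0`) and `x` is a point of the face
`{y : y i = 1}` of `Q`, whose outer unit normal is `e = r (eᵢ)`, then
`∠(x, e) ≤ π/2 − arcsin(1/√d)`. -/
theorem stmt5 (d : ℕ) (hd : 1 ≤ d)
    (l : ℝ) (hl : 0 < l) (r : Euc d ≃ₗᵢ[ℝ] Euc d) (v : Euc d)
    (c : Euc d) (hc : ∀ i, c i = 1/2) (hcenter : l • r c + v = 0)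
    (i : Fin d) (y : Euc d) (hyi : y i = 1) (hy : ∀ j, y j ∈ Set.Icc (0:ℝ) 1)
    (x : Euc d) (hx : x = l • r y + v) :
    InnerProductGeometry.angle x (r (EuclideanSpace.single i 1)) ≤
      Real.pi / 2 - Real.arcsin (1 / Real.sqrt d) := by
  have hx' : x = l • r (y - c) := by
    rw [hx, map_sub, smul_sub, eq_neg_of_add_eq_zero_right hcenter, sub_eq_add_neg]
  rw [hx', InnerProductGeometry.angle_smul_left_of_pos _ _ hl, ← r.coe_toLinearIsometry,
    LinearIsometry.angle_map,
    InnerProductGeometry.angle, Real.arccos]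
  refine sub_le_sub_left (Real.monotone_arcsin ?_) _
  have hinner : inner ℝ (y - c) (EuclideanSpace.single i (1 : ℝ)) = 1 / 2 := by
    rw [EuclideanSpace.inner_single_right]
    simp [hyi, hc]
    norm_num
  have hnorm : ‖y - c‖ ≤ Real.sqrt d / 2 := by
    rw [EuclideanSpace.norm_eq, Real.sqrt_le_left (by positivity), div_pow,
      Real.sq_sqrt (Nat.cast_nonneg d)]
    calc ∑ j, ‖(y - c) j‖ ^ 2 ≤ ∑ _j : Fin d, (1 / 4 : ℝ) := by
          refine Finset.sum_le_sum fun j _ => ?_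
          obtain ⟨h0, h1⟩ := hy j
          rw [Real.norm_eq_abs, sq_abs, PiLp.sub_apply, hc]
          nlinarith
      _ = (d : ℝ) / 2 ^ 2 := by
          rw [Finset.sum_const, Finset.card_univ, Fintype.card_fin, nsmul_eq_mul]
          ring
  have hpos : 0 < ‖y - c‖ := by
    refine norm_pos_iff.mpr fun h => ?_
    rw [h, inner_zero_left] at hinner
    norm_num at hinner
  have hd' : 0 < Real.sqrt d := Real.sqrt_pos.mpr (Nat.cast_pos.mpr hd)
  rw [hinner, PiLp.norm_single, norm_one, mul_one, div_le_div_iff₀ hd' hpos]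
  linarith
end
end

section
/- For every ε > 0 there exists N > 0 such that the following holds: if B ⊂ ℝ^d is a ball centered in the origin, y₁, y₂ ∈ B, and x₁, x₂ ∈ ℝ^d satisfy |x₁|, |x₂| ≥ (N+1)·diam(B)/2 and ∠(x₁, x₂) ≤ ε, then ∠(y₁ − x₁, y₂ − x₂) ≤ 2ε. -/
open MeasureTheory Metric Set Filter
open scoped ENNReal NNReal Topology

noncomputable section

/-- If `y` is short compared to `x`, then subtracting `y` from `x` changes the direction by an
angle of at most `δ`. -/
theorem angle_sub_le_of_norm_le {V : Type*} [NormedAddCommGroup V] [InnerProductSpace ℝ V]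
    {δ : ℝ} (hδ : 0 ≤ δ) (hδ' : δ ≤ Real.pi / 2) {x y : V} (hx : x ≠ 0) (hxy : x - y ≠ 0)
    (h : (1 + Real.cos δ) * ‖y‖ ≤ (1 - Real.cos δ) * ‖x‖) :
    InnerProductGeometry.angle x (x - y) ≤ δ := by
  have hc : 0 ≤ Real.cos δ := Real.cos_nonneg_of_mem_Icc ⟨by linarith [Real.pi_pos], hδ'⟩
  have hpos : 0 < ‖x‖ * ‖x - y‖ := by positivity
  have hinner : ‖x‖ * (‖x‖ - ‖y‖) ≤ inner ℝ x (x - y) := by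
    rw [inner_sub_right, real_inner_self_eq_norm_sq]
    linarith [real_inner_le_norm x y]
  rw [InnerProductGeometry.angle,
    ← Real.arccos_cos hδ (by linarith [Real.pi_pos] : δ ≤ Real.pi)]
  apply Real.arccos_le_arccos
  rw [le_div_iff₀ hpos]
  calc Real.cos δ * (‖x‖ * ‖x - y‖) ≤ Real.cos δ * (‖x‖ * (‖x‖ + ‖y‖)) := by
        gcongr
        exact norm_sub_le x y
    _ = ‖x‖ * (Real.cos δ * (‖x‖ + ‖y‖)) := by ring
    _ ≤ ‖x‖ * (‖x‖ - ‖y‖) := by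
        gcongr
        linarith
    _ ≤ inner ℝ x (x - y) := hinner

/-- for every `ε > 0` there is `N > 0` such that for every ball `B`
centered in the origin, all `y₁, y₂ ∈ B` and all `x₁, x₂` with
`|x₁|, |x₂| ≥ (N+1) diam(B)/2` and `∠(x₁,x₂) ≤ ε`, one has `∠(y₁−x₁, y₂−x₂) ≤ 2ε`. -/
theorem stmt6 (d : ℕ) (hd : 1 ≤ d) :
    ∀ ε : ℝ, 0 < ε → ∃ N : ℝ, 0 < N ∧
      ∀ (R : ℝ) (y₁ y₂ x₁ x₂ : Euc d),
        y₁ ∈ Metric.ball (0 : Euc d) R → y₂ ∈ Metric.ball (0 : Euc d) R →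
        (N + 1) * Metric.diam (Metric.ball (0 : Euc d) R) / 2 ≤ ‖x₁‖ →
        (N + 1) * Metric.diam (Metric.ball (0 : Euc d) R) / 2 ≤ ‖x₂‖ →
        InnerProductGeometry.angle x₁ x₂ ≤ ε →
        InnerProductGeometry.angle (y₁ - x₁) (y₂ - x₂) ≤ 2 * ε := by
  intro ε hε
  have : Nonempty (Fin d) := ⟨⟨0, hd⟩⟩
  set δ := min (ε / 2) 1 with hδ
  have hδ0 : 0 < δ := by positivity
  have hδε : δ ≤ ε / 2 := min_le_left _ _
  have hδπ : δ ≤ Real.pi / 2 := (min_le_right _ _).trans (by linarith [Real.pi_gt_three])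
  have hc : Real.cos δ < 1 := by
    rw [← Real.cos_zero]
    exact Real.cos_lt_cos_of_nonneg_of_le_pi_div_two le_rfl hδπ hδ0
  have hc' : 0 < 1 - Real.cos δ := by linarith
  refine ⟨2 / (1 - Real.cos δ), by positivity, ?_⟩
  intro R y₁ y₂ x₁ x₂ hy₁ hy₂ hx₁ hx₂ hangle
  have hR : 0 < R := pos_of_mem_ball hy₁
  have hdiam : Metric.diam (Metric.ball (0 : Euc d) R) = 2 * R := diam_ball_eq _ hR.le
  rw [hdiam] at hx₁ hx₂
  have key : ∀ x y : Euc d, y ∈ Metric.ball (0 : Euc d) R →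
      (2 / (1 - Real.cos δ) + 1) * (2 * R) / 2 ≤ ‖x‖ →
      InnerProductGeometry.angle x (x - y) ≤ δ := by
    intro x y hy hx
    rw [mem_ball_zero_iff] at hy
    have hN : 0 < 2 / (1 - Real.cos δ) * R := by positivity
    have hlt : ‖y‖ < ‖x‖ := by linarith
    have hx0 : x ≠ 0 := norm_pos_iff.mp ((norm_nonneg y).trans_lt hlt)
    have hxy : x - y ≠ 0 := sub_ne_zero.mpr fun h => hlt.ne (by rw [h])
    refine angle_sub_le_of_norm_le hδ0.le hδπ hx0 hxy ?_
    calc (1 + Real.cos δ) * ‖y‖ ≤ 2 * R := by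
          gcongr
          linarith
      _ = (1 - Real.cos δ) * (2 / (1 - Real.cos δ) * R) := by field_simp
      _ ≤ (1 - Real.cos δ) * ‖x‖ := by
          gcongr
          linarith
  have h₁ := key x₁ y₁ hy₁ hx₁
  have h₂ := key x₂ y₂ hy₂ hx₂
  rw [← InnerProductGeometry.angle_neg_neg, neg_sub, neg_sub]
  rw [InnerProductGeometry.angle_comm] at h₁
  have t₁ := InnerProductGeometry.angle_le_angle_add_angle (x₁ - y₁) x₁ (x₂ - y₂)
  have t₂ := InnerProductGeometry.angle_le_angle_add_angle x₁ x₂ (x₂ - y₂)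
  linarith
end
end

section
/- Let ε ∈ (0,1), let E ⊂ ℝ^d be a measurable set of locally finite perimeter, and let Q be a finite set of cubes such that |E ∩ Q| > ε|Q| for each Q ∈ Q. Then H^{d−1}( ∂(∪Q) \ cl* E ) ≤ C_{d,ε} H^{d−1}( ∂* E ∩ ∪Q ), where C_{d,ε} depends only on d and ε. -/
open MeasureTheory Metric Set Filter
open scoped ENNReal NNReal Topology

noncomputable section

/-- Points at which `E` has density at most `c` at every scale below `1 / (k + 1)`. -/
def thin (d : ℕ) (E : Set (Euc d)) (c : ℝ≥0∞) (k : ℕ) : Set (Euc d) :=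
  {x | ∀ r : ℝ, 0 < r → r < 1 / ((k : ℝ) + 1) → volume (ball x r ∩ E) ≤ c * volume (ball x r)}

theorem isClosed_thin (d : ℕ) (E : Set (Euc d)) (c : ℝ≥0∞) (k : ℕ) :
    IsClosed (thin d E c k) := by
  have key : ∀ r : ℝ, IsClosed {x : Euc d | volume (ball x r ∩ E) ≤ c * volume (ball x r)} := by
    intro r
    rw [← isOpen_compl_iff, Metric.isOpen_iff]
    intro x hx
    simp only [mem_compl_iff, mem_ofPred_eq, not_le] at hx
    have hU : ball x r = ⋃ n : ℕ, ball x (r - 1 / ((n : ℝ) + 1)) := by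
      ext y
      simp only [mem_iUnion, mem_ball]
      constructor
      · intro hy
        obtain ⟨n, hn⟩ := exists_nat_one_div_lt (sub_pos.2 hy)
        exact ⟨n, by linarith⟩
      · rintro ⟨n, hn⟩
        have : 0 < 1 / ((n : ℝ) + 1) := Nat.one_div_pos_of_nat
        linarith
    have hm : Monotone fun n : ℕ => ball x (r - 1 / ((n : ℝ) + 1)) ∩ E := by
      intro a b hab
      have : (a : ℝ) ≤ b := by exact_mod_cast hab
      exact inter_subset_inter_left _ (ball_subset_ball (by gcongr))
    have hx' := hx
    rw [show ball x r ∩ E = ⋃ n : ℕ, (ball x (r - 1 / ((n : ℝ) + 1)) ∩ E) by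
      rw [← iUnion_inter, ← hU], hm.measure_iUnion, lt_iSup_iff] at hx'
    obtain ⟨n, hn⟩ := hx'
    refine ⟨1 / ((n : ℝ) + 1), Nat.one_div_pos_of_nat, fun y hy => ?_⟩
    simp only [mem_compl_iff, mem_ofPred_eq, not_le]
    rw [Measure.addHaar_ball_center] at hn ⊢
    refine hn.trans_le (measure_mono (inter_subset_inter_left _ (ball_subset_ball' ?_)))
    rw [mem_ball, dist_comm] at hy
    linarith
  have : thin d E c k = ⋂ (r : ℝ) (_ : 0 < r) (_ : r < 1 / ((k : ℝ) + 1)),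
      {x : Euc d | volume (ball x r ∩ E) ≤ c * volume (ball x r)} := by
    ext x; simp [thin]
  rw [this]
  exact isClosed_iInter fun r => isClosed_iInter fun _ => isClosed_iInter fun _ => key r

theorem exists_mem_thin_of_notMem_mClosure {d : ℕ} {E : Set (Euc d)} {c : ℝ≥0∞} (hc : c ≠ 0)
    {x : Euc d} (hx : x ∉ mClosure d E) : ∃ k, x ∈ thin d E c k := by
  have hx0 : limsup (fun r : ℝ => volume (Metric.ball x r ∩ E) / ENNReal.ofReal (r ^ d))
      (nhdsWithin 0 (Set.Ioi 0)) = 0 := by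
    simpa [mClosure] using hx
  have hpos : 0 < c * volume (ball (0 : Euc d) 1) :=
    ENNReal.mul_pos hc (measure_ball_pos _ _ one_pos).ne'
  have hev := eventually_lt_of_limsup_lt (hx0.trans_lt hpos)
  rw [eventually_nhdsWithin_iff, Metric.eventually_nhds_iff] at hev
  obtain ⟨δ, hδ, hev⟩ := hev
  obtain ⟨k, hk⟩ := exists_nat_one_div_lt hδ
  refine ⟨k, fun r hr0 hr => ?_⟩
  have h1 := (hev (y := r) (by rw [Real.dist_eq, sub_zero, abs_of_pos hr0]; linarith) hr0).le
  rw [ENNReal.div_le_iff (by simpa using pow_pos hr0 d) ENNReal.ofReal_ne_top] at h1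
  refine h1.trans_eq ?_
  rw [Measure.addHaar_ball_of_pos volume x hr0, finrank_euclideanSpace_fin]
  ring

theorem ae_notMem_thin (d : ℕ) (E : Set (Euc d)) {c : ℝ≥0∞} (hc : c < 1) :
    ∀ᵐ x ∂(volume.restrict E), ∀ k, x ∉ thin d E c k := by
  filter_upwards [Besicovitch.ae_tendsto_measure_inter_div (volume : Measure (Euc d)) E] with x hx k
    hxk
  have hev := hx.eventually (lt_mem_nhds hc)
  rw [eventually_nhdsWithin_iff, Metric.eventually_nhds_iff] at hev
  obtain ⟨δ, hδ, hev⟩ := hev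
  have hk : 0 < 1 / ((k : ℝ) + 1) := Nat.one_div_pos_of_nat
  obtain ⟨r, hr0, hr⟩ := exists_between (lt_min hδ hk)
  have h1 := hev (y := r) (by
    rw [Real.dist_eq, sub_zero, abs_of_pos hr0]; exact hr.trans_le (min_le_left _ _)) hr0
  have h2 := hxk r hr0 (hr.trans_le (min_le_right _ _))
  have h3 : volume (E ∩ closedBall x r) ≤ volume (ball x r ∩ E) := by
    calc volume (E ∩ closedBall x r) ≤ volume ((ball x r ∩ E) ∪ sphere x r) := by
          refine measure_mono ?_
          rintro y ⟨hyE, hy⟩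
          rw [← ball_union_sphere] at hy
          rcases hy with hy | hy
          · exact Or.inl ⟨hy, hyE⟩
          · exact Or.inr hy
      _ ≤ volume (ball x r ∩ E) + volume (sphere x r) := measure_union_le _ _
      _ = _ := by rw [Measure.addHaar_sphere_of_ne_zero _ _ hr0.ne', add_zero]
  rw [ENNReal.lt_div_iff_mul_lt (Or.inl (measure_closedBall_pos _ _ hr0).ne')
    (Or.inl measure_closedBall_lt_top.ne)] at h1
  refine absurd (h1.trans_le (h3.trans (h2.trans ?_))) (lt_irrefl _)
  gcongr
  exact ball_subset_closedBall

/-- A density threshold small enough for the slicing arguments. -/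
def thinConst (d : ℕ) : ℝ≥0∞ := 2⁻¹ * (7 ^ d)⁻¹

theorem thinConst_ne_zero (d : ℕ) : thinConst d ≠ 0 := by
  simp [thinConst]

theorem thinConst_lt_one (d : ℕ) : thinConst d < 1 := by
  have h : ((7 : ℝ≥0∞) ^ d)⁻¹ ≤ 1 := by
    rw [ENNReal.inv_le_one]
    exact one_le_pow₀ (by norm_num)
  calc thinConst d ≤ 2⁻¹ * 1 := by unfold thinConst; gcongr
    _ < 1 := by rw [mul_one]; exact ENNReal.one_half_lt_one

theorem measurableSet_ae_line {d : ℕ} {E : Set (Euc d)} (hE : MeasurableSet E) (v : Euc d)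
    {I : Set ℝ} (hI : MeasurableSet I) :
    MeasurableSet {y : Euc d | ∀ᵐ s : ℝ, s ∈ I → y + s • v ∈ E} := by
  have hf : Measurable fun p : Euc d × ℝ => p.1 + p.2 • v := by fun_prop
  have hM : MeasurableSet {p : Euc d × ℝ | p.2 ∈ I ∧ p.1 + p.2 • v ∈ Eᶜ} :=
    (measurable_snd hI).inter (hf hE.compl)
  have := measurable_measure_prodMk_left (ν := (volume : Measure ℝ)) hM
    (measurableSet_singleton 0)
  convert this using 1
  ext y
  simp only [mem_ofPred_eq, ae_iff, mem_preimage, mem_singleton_iff, mem_compl_iff,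
    Classical.not_imp]
  rfl

theorem volume_notMem_of_ae_line_near {d : ℕ} {E : Set (Euc d)} (hE : MeasurableSet E)
    (v : Euc d) :
    volume {y : Euc d | y ∉ E ∧ ∃ m : ℕ, ∀ᵐ s : ℝ,
      s ∈ Ioo (-(1 / ((m : ℝ) + 1))) (1 / ((m : ℝ) + 1)) → y + s • v ∈ E} = 0 := by
  set D : ℕ → Set (Euc d) := fun m => Eᶜ ∩ {y : Euc d | ∀ᵐ s : ℝ,
      s ∈ Ioo (-(1 / ((m : ℝ) + 1))) (1 / ((m : ℝ) + 1)) → y + s • v ∈ E} with hD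
  have hDm : ∀ m, MeasurableSet (D m) := fun m =>
    hE.compl.inter (measurableSet_ae_line hE v measurableSet_Ioo)
  suffices h : ∀ m, volume (D m) = 0 by
    refine measure_mono_null ?_ (measure_iUnion_null h)
    rintro y ⟨hy, m, hm⟩
    exact mem_iUnion.2 ⟨m, hy, hm⟩
  intro m
  have hae : ∀ᵐ y : Euc d, y ∈ (D m)ᶜ := by
    refine ae_mem_of_ae_add_linearMap_mem (LinearMap.toSpanSingleton ℝ (Euc d) v)
      (volume : Measure ℝ) volume (hDm m).compl fun y => ?_
    rw [ae_iff]
    refine measure_null_of_locally_null _ fun t ht => ?_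
    simp only [LinearMap.toSpanSingleton_apply, mem_compl_iff, not_not, mem_ofPred_eq] at ht
    have hpos : 0 < 1 / ((m : ℝ) + 1) := Nat.one_div_pos_of_nat
    refine ⟨_, inter_mem (mem_nhdsWithin_of_mem_nhds (Ioo_mem_nhds (sub_lt_self t hpos)
      (lt_add_of_pos_right t hpos))) self_mem_nhdsWithin, ?_⟩
    have h2 := (measurePreserving_add_right (volume : Measure ℝ) (-t)).quasiMeasurePreserving.ae
      ht.2
    have h3 : ∀ᵐ s : ℝ, s ∉ Ioo (t - 1 / ((m : ℝ) + 1)) (t + 1 / ((m : ℝ) + 1)) ∨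
        y + s • v ∈ E := by
      filter_upwards [h2] with s hs
      by_cases h : s ∈ Ioo (t - 1 / ((m : ℝ) + 1)) (t + 1 / ((m : ℝ) + 1))
      · right
        have := hs ⟨by linarith [h.1], by linarith [h.2]⟩
        rwa [add_assoc, ← add_smul, show t + (s + -t) = s by ring] at this
      · exact Or.inl h
    refine measure_mono_null ?_ (ae_iff.1 h3)
    rintro s ⟨hs1, hs2⟩
    simp only [LinearMap.toSpanSingleton_apply, mem_compl_iff, not_not, mem_ofPred_eq] at hs2
    rintro (h | h)
    exacts [h hs1, hs2.1 h]
  rw [ae_iff] at hae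
  exact measure_mono_null (fun y hy => not_not.2 hy) hae

theorem volume_lines_through_thin_slab {d : ℕ} {E : Set (Euc d)} (hE : MeasurableSet E)
    {v : Euc d} (hv : v ≠ 0) (k : ℕ) {δ : ℝ} (hδ : 0 < δ) (j : ℝ) {A : Set (Euc d)}
    (hA : A ⊆ thin d E (thinConst d) k)
    (hAE : ∀ x ∈ A, ∀ᵐ s : ℝ, s ∈ Ioo 0 δ → x + s • v ∈ E)
    (hAj : ∀ x ∈ A, j ≤ inner ℝ v x / ‖v‖ ^ 2 ∧ inner ℝ v x / ‖v‖ ^ 2 ≤ j + δ / 2) :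
    volume {y : Euc d | ∃ t : ℝ, y + t • v ∈ A} = 0 := by
  have hv0 : 0 < ‖v‖ := norm_pos_iff.2 hv
  set τ : Euc d → ℝ := fun x => inner ℝ v x / ‖v‖ ^ 2 with hτ
  have hτadd : ∀ x (t : ℝ), τ (x + t • v) = τ x + t := by
    intro x t
    simp only [hτ, inner_add_right, inner_smul_right, real_inner_self_eq_norm_sq]
    field_simp
  have hτlip : ∀ x y, τ x - τ y ≤ dist x y / ‖v‖ := by
    intro x y
    have h1 : inner ℝ v (x - y) ≤ ‖v‖ * ‖x - y‖ := real_inner_le_norm _ _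
    rw [dist_eq_norm]
    simp only [hτ]
    rw [← sub_div, ← inner_sub_right, div_le_div_iff₀ (by positivity) hv0]
    nlinarith
  set S : Set (Euc d) := {y : Euc d | ∃ t : ℝ, y + t • v ∈ A} with hS
  by_contra hne
  have : (ae (volume.restrict S)).NeBot := by
    rw [ae_neBot]
    simpa [Measure.restrict_eq_zero] using hne
  obtain ⟨z0, hz0⟩ :=
    (Besicovitch.ae_tendsto_measure_inter_div (volume : Measure (Euc d)) S).exists
  have hev := hz0.eventually (lt_mem_nhds (ENNReal.one_half_lt_one))
  rw [eventually_nhdsWithin_iff, Metric.eventually_nhds_iff] at hev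
  obtain ⟨ρ, hρ, hev⟩ := hev
  have hk : 0 < 1 / ((k : ℝ) + 1) := Nat.one_div_pos_of_nat
  obtain ⟨r, hr0, hr⟩ := exists_between
    (show 0 < min ρ (min (δ * ‖v‖ / 8) (1 / ((k : ℝ) + 1) / 7)) by positivity)
  have hr1 : r < ρ := hr.trans_le (min_le_left _ _)
  have hr2 : r < δ * ‖v‖ / 8 := hr.trans_le ((min_le_right _ _).trans (min_le_left _ _))
  have hr3 : r < 1 / ((k : ℝ) + 1) / 7 := hr.trans_le ((min_le_right _ _).trans (min_le_right _ _))
  have hhalf := hev (y := r) (by rwa [Real.dist_eq, sub_zero, abs_of_pos hr0]) hr0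
  rw [ENNReal.lt_div_iff_mul_lt (Or.inl (measure_closedBall_pos _ _ hr0).ne')
    (Or.inl measure_closedBall_lt_top.ne)] at hhalf
  set H : Set ℝ := τ '' {x | x ∈ A ∧ ∃ t : ℝ, x + t • v ∈ closedBall z0 r} with hH
  have hHne : H.Nonempty := by
    have : (S ∩ closedBall z0 r).Nonempty := nonempty_of_measure_ne_zero
      ((zero_le).trans_lt hhalf).ne'
    obtain ⟨y, ⟨t, hyt⟩, hy⟩ := this
    refine ⟨_, _, ⟨hyt, -t, ?_⟩, rfl⟩
    simpa using hy
  have hHb : ∀ a ∈ H, a ≤ j + δ / 2 := by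
    rintro _ ⟨x, ⟨hx, -⟩, rfl⟩
    exact (hAj x hx).2
  set T := sSup H with hT
  have hTle : T ≤ j + δ / 2 := csSup_le hHne hHb
  have hρv : 0 < r / ‖v‖ := by positivity
  obtain ⟨_, ⟨x, ⟨hxA, t, hxt⟩, rfl⟩, hxT⟩ :=
    exists_lt_of_lt_csSup hHne (show T - r / ‖v‖ < sSup H by linarith)
  have hxT' : τ x ≤ T := le_csSup ⟨_, hHb⟩ ⟨x, ⟨hxA, t, hxt⟩, rfl⟩
  set w := (T + 2 * (r / ‖v‖) - τ z0) with hw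
  set z1 := z0 + w • v with hz1
  have hτz1 : τ z1 = T + 2 * (r / ‖v‖) := by rw [hz1, hτadd]; ring
  have hτball : ∀ y ∈ closedBall z1 r, T + r / ‖v‖ ≤ τ y ∧ τ y ≤ T + 3 * (r / ‖v‖) := by
    intro y hy
    rw [mem_closedBall] at hy
    have h1 := hτlip y z1
    have h2 := hτlip z1 y
    rw [dist_comm] at h2
    have h3 : dist y z1 / ‖v‖ ≤ r / ‖v‖ := by gcongr
    constructor <;> linarith
  have hshift : ∀ y, y ∈ closedBall z0 r ↔ y + w • v ∈ closedBall z1 r := by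
    intro y; simp [hz1]
  have hx7 : closedBall z1 r ⊆ ball x (7 * r) := by
    set t' := t + w with ht'
    have hmem : x + t' • v ∈ closedBall z1 r := by
      rw [ht', add_smul, ← add_assoc]; exact (hshift _).1 hxt
    have h1 := hτball _ hmem
    rw [hτadd] at h1
    have h2 : |t'| ≤ 4 * (r / ‖v‖) := abs_le.2 ⟨by linarith, by linarith⟩
    have h3 : dist (x + t' • v) x ≤ 4 * r := by
      rw [dist_eq_norm, add_sub_cancel_left, norm_smul, Real.norm_eq_abs]
      calc |t'| * ‖v‖ ≤ 4 * (r / ‖v‖) * ‖v‖ := by gcongr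
        _ = 4 * r := by field_simp
    intro y hy
    rw [mem_closedBall] at hy hmem
    rw [mem_ball]
    have := dist_triangle4 y z1 (x + t' • v) x
    rw [dist_comm z1] at this
    linarith
  have hvol : volume (S ∩ closedBall z1 r) = volume (S ∩ closedBall z0 r) := by
    rw [← measure_preimage_add_right volume (w • v) (S ∩ closedBall z1 r)]
    congr 1
    ext y
    simp only [mem_preimage, mem_inter_iff, ← hshift]
    refine and_congr_left fun _ => ⟨?_, ?_⟩
    · rintro ⟨a, ha⟩
      exact ⟨w + a, by rwa [add_smul, ← add_assoc]⟩
    · rintro ⟨a, ha⟩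
      refine ⟨a - w, ?_⟩
      rwa [add_assoc, ← add_smul, add_sub_cancel]
  have hsub : S ∩ closedBall z1 r ⊆ (ball x (7 * r) ∩ E) ∪ {y : Euc d | y ∉ E ∧ ∃ m : ℕ,
      ∀ᵐ s : ℝ, s ∈ Ioo (-(1 / ((m : ℝ) + 1))) (1 / ((m : ℝ) + 1)) → y + s • v ∈ E} := by
    rintro y ⟨⟨a, ha⟩, hy⟩
    by_cases hyE : y ∈ E
    · exact Or.inl ⟨hx7 hy, hyE⟩
    refine Or.inr ⟨hyE, ?_⟩
    have h1 := hτball y hy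
    have h2 : τ (y + a • v) ≤ T := by
      refine le_csSup ⟨_, hHb⟩ ⟨_, ⟨ha, -a - w, ?_⟩, rfl⟩
      rw [hshift]
      convert hy using 1
      module
    have h3 := (hAj _ ha).1
    change j ≤ τ (y + a • v) at h3
    rw [hτadd] at h2 h3
    have h4 : r / ‖v‖ < δ / 8 := by
      rw [div_lt_iff₀ hv0]; linarith
    obtain ⟨m, hm⟩ := exists_nat_one_div_lt (show 0 < min (-a) (δ + a) from
      lt_min (by linarith) (by linarith))
    have hm1 := hm.trans_le (min_le_left _ _)
    have hm2 := hm.trans_le (min_le_right _ _)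
    refine ⟨m, ?_⟩
    have h5 := (measurePreserving_add_right (volume : Measure ℝ) (-a)).quasiMeasurePreserving.ae
      (hAE _ ha)
    filter_upwards [h5] with s hs hsm
    have := hs ⟨by linarith [hsm.1], by linarith [hsm.2]⟩
    convert this using 1
    module
  have h7 := hA hxA (7 * r) (by positivity) (by linarith)
  have hle : volume (S ∩ closedBall z0 r) ≤ 2⁻¹ * volume (closedBall z0 r) := by
    calc volume (S ∩ closedBall z0 r) ≤ volume (ball x (7 * r) ∩ E) + 0 := by
          rw [← hvol, ← volume_notMem_of_ae_line_near hE v]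
          exact (measure_mono hsub).trans (measure_union_le _ _)
      _ ≤ thinConst d * volume (ball x (7 * r)) := by rwa [add_zero]
      _ = 2⁻¹ * volume (ball z0 r) := by
          rw [Measure.addHaar_ball_of_pos volume x (by positivity : 0 < 7 * r),
            Measure.addHaar_ball_of_pos volume z0 hr0, finrank_euclideanSpace_fin, thinConst,
            mul_pow, ENNReal.ofReal_mul (by positivity), ENNReal.ofReal_pow (by norm_num)]
          have h77 : ENNReal.ofReal 7 = 7 := by simp
          rw [h77, mul_assoc, mul_assoc, ← mul_assoc (((7 : ℝ≥0∞) ^ d)⁻¹),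
            ENNReal.inv_mul_cancel (by simp) (by simp), one_mul]
      _ ≤ _ := by gcongr; exact ball_subset_closedBall
  exact absurd (hhalf.trans_le hle) (lt_irrefl _)

theorem volume_lines_through_thin {d : ℕ} {E : Set (Euc d)} (hE : MeasurableSet E)
    {v : Euc d} (hv : v ≠ 0) :
    volume {y : Euc d | ∃ t : ℝ, (∃ k, y + t • v ∈ thin d E (thinConst d) k) ∧
      ∃ δ > 0, ∀ᵐ s : ℝ, s ∈ Ioo 0 δ → y + t • v + s • v ∈ E} = 0 := by
  let A : ℕ → ℕ → ℤ → Set (Euc d) := fun k m j =>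
    {x | x ∈ thin d E (thinConst d) k ∧ (∀ᵐ s : ℝ, s ∈ Ioo 0 (1 / ((m : ℝ) + 1)) → x + s • v ∈ E) ∧
      j * (1 / ((m : ℝ) + 1) / 2) ≤ inner ℝ v x / ‖v‖ ^ 2 ∧
      inner ℝ v x / ‖v‖ ^ 2 ≤ j * (1 / ((m : ℝ) + 1) / 2) + 1 / ((m : ℝ) + 1) / 2}
  have h0 : ∀ k m j, volume {y : Euc d | ∃ t : ℝ, y + t • v ∈ A k m j} = 0 := fun k m j =>
    volume_lines_through_thin_slab hE hv k Nat.one_div_pos_of_nat _ (fun x hx => hx.1)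
      (fun x hx => hx.2.1) (fun x hx => hx.2.2)
  refine measure_mono_null ?_ (measure_iUnion_null fun k => measure_iUnion_null fun m =>
    measure_iUnion_null fun j => h0 k m j)
  rintro y ⟨t, ⟨k, hk⟩, δ, hδ, hs⟩
  obtain ⟨m, hm⟩ := exists_nat_one_div_lt hδ
  have hpos : (0 : ℝ) < 1 / ((m : ℝ) + 1) / 2 := by positivity
  simp only [mem_iUnion]
  refine ⟨k, m, ⌊inner ℝ v (y + t • v) / ‖v‖ ^ 2 / (1 / ((m : ℝ) + 1) / 2)⌋, t, hk, ?_, ?_, ?_⟩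
  · filter_upwards [hs] with s h h'
    exact h ⟨h'.1, h'.2.trans hm⟩
  · rw [← le_div_iff₀ hpos]; exact Int.floor_le _
  · have := (Int.lt_floor_add_one (inner ℝ v (y + t • v) / ‖v‖ ^ 2 / (1 / ((m : ℝ) + 1) / 2))).le
    rw [div_le_iff₀ hpos] at this
    linarith

/-- `P` holds almost everywhere near `t`. -/
def AENear (P : ℝ → Prop) (t : ℝ) : Prop :=
  ∃ c d : ℝ, c < t ∧ t < d ∧ ∀ᵐ s : ℝ, s ∈ Ioo c d → P s

theorem isOpen_aenear (P : ℝ → Prop) : IsOpen {t | AENear P t} := by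
  rw [isOpen_iff_mem_nhds]
  rintro t ⟨c, d, hc, hd, h⟩
  filter_upwards [Ioo_mem_nhds hc hd] with s hs
  exact ⟨c, d, hs.1, hs.2, h⟩

theorem not_ae_of_ae_not {P : ℝ → Prop} {a b : ℝ} (hab : a < b)
    (h : ∀ᵐ s : ℝ, s ∈ Ioo a b → P s) : ¬ ∀ᵐ s : ℝ, s ∈ Ioo a b → ¬ P s := by
  intro h'
  have : volume (Ioo a b) = 0 := by
    refine measure_mono_null ?_ (ae_iff.1 (h.and h'))
    intro s hs h2
    exact h2.2 hs (h2.1 hs)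
  rw [Real.volume_Ioo, ENNReal.ofReal_eq_zero] at this
  linarith

theorem ae_Ioo_of_forall_aenear {P : ℝ → Prop} {a b : ℝ} (h : ∀ t ∈ Ioo a b, AENear P t) :
    ∀ᵐ t : ℝ, t ∈ Ioo a b → P t := by
  rw [ae_iff]
  refine measure_null_of_locally_null _ fun t ht => ?_
  simp only [mem_ofPred_eq, Classical.not_imp] at ht
  obtain ⟨c, d, hc, hd, hcd⟩ := h t ht.1
  refine ⟨_, inter_mem (mem_nhdsWithin_of_mem_nhds (Ioo_mem_nhds hc hd)) self_mem_nhdsWithin, ?_⟩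
  refine measure_mono_null ?_ (ae_iff.1 hcd)
  rintro s ⟨hs1, hs2⟩ hs3
  exact hs2 fun _ => hs3 hs1

theorem AENear.not_not {P : ℝ → Prop} {t : ℝ} (h : AENear P t) :
    ¬ AENear (fun s => ¬ P s) t := by
  rintro ⟨c', d', hc', hd', h'⟩
  obtain ⟨c, d, hc, hd, h⟩ := h
  refine not_ae_of_ae_not (show max c c' < min d d' by
    simp only [max_lt_iff, lt_min_iff]; constructor <;> constructor <;> linarith)
    (h.mono fun s hs hs' => hs ?_) (h'.mono fun s hs hs' => hs ?_)
  · exact ⟨(le_max_left _ _).trans_lt hs'.1, hs'.2.trans_le (min_le_left _ _)⟩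
  · exact ⟨(le_max_right _ _).trans_lt hs'.1, hs'.2.trans_le (min_le_right _ _)⟩

theorem ae_Ioo_or_ae_not_of_forall_aenear {P : ℝ → Prop} {a b : ℝ}
    (h : ∀ t ∈ Ioo a b, AENear P t ∨ AENear (fun s => ¬ P s) t) :
    (∀ᵐ t : ℝ, t ∈ Ioo a b → P t) ∨ ∀ᵐ t : ℝ, t ∈ Ioo a b → ¬ P t := by
  by_cases h1 : ∀ t ∈ Ioo a b, AENear P t
  · exact Or.inl (ae_Ioo_of_forall_aenear h1)
  by_cases h2 : ∀ t ∈ Ioo a b, AENear (fun s => ¬ P s) t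
  · exact Or.inr (ae_Ioo_of_forall_aenear h2)
  exfalso
  push Not at h1 h2
  obtain ⟨t, ht, ht1⟩ := h1
  obtain ⟨s, hs, hs1⟩ := h2
  obtain ⟨u, -, hu1, hu2⟩ := isPreconnected_Ioo (a := a) (b := b) _ _ (isOpen_aenear P)
    (isOpen_aenear fun s => ¬ P s) h ⟨s, hs, (h s hs).resolve_right hs1⟩
    ⟨t, ht, (h t ht).resolve_left ht1⟩
  exact hu1.not_not hu2

/-- If the points of `Ioo a b` near which neither `P` nor its negation holds almost everywhere
all lie in a set `G` that carries almost no `P` and whose points have no one-sided neighbourhood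
full of `P`, then there are no such points. -/
theorem aenear_or_of_subset {P : ℝ → Prop} {G : Set ℝ} (hG : ∀ᵐ t : ℝ, t ∈ G → ¬ P t)
    (hr : ∀ t ∈ G, ∀ δ > 0, ¬ ∀ᵐ s : ℝ, s ∈ Ioo t (t + δ) → P s)
    (hl : ∀ t ∈ G, ∀ δ > 0, ¬ ∀ᵐ s : ℝ, s ∈ Ioo (t - δ) t → P s) {a b : ℝ}
    (hF : ∀ t ∈ Ioo a b, ¬ AENear P t → ¬ AENear (fun s => ¬ P s) t → t ∈ G) :
    ∀ t ∈ Ioo a b, AENear P t ∨ AENear (fun s => ¬ P s) t := by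
  by_contra! hcon
  obtain ⟨p, hp, hp1, hp2⟩ := hcon
  set C : Set ℝ := {t | AENear P t}ᶜ ∩ {t | AENear (fun s => ¬ P s) t}ᶜ with hC
  have hCc : IsClosed C := (isOpen_aenear _).isClosed_compl.inter (isOpen_aenear _).isClosed_compl
  have hpC : p ∈ C := ⟨hp1, hp2⟩
  have hnC : ∀ t, t ∉ C → AENear P t ∨ AENear (fun s => ¬ P s) t := by
    intro t ht
    by_contra! h
    exact ht h
  have hno : ∀ t ∈ Ioo a b, ¬ AENear P t := by
    intro t ht htP
    obtain ⟨c, d, hc, hd, hcd⟩ := id htP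
    have htC : t ∉ C := fun h => h.1 htP
    rcases lt_trichotomy p t with hpt | rfl | hpt
    · have hK : IsCompact (C ∩ Icc p t) := isCompact_Icc.inter_left hCc
      obtain ⟨q, ⟨hqC, hq⟩, hqmax⟩ := hK.exists_isGreatest ⟨p, hpC, le_rfl, hpt.le⟩
      have hqt : q < t := lt_of_le_of_ne hq.2 fun h => htC (h ▸ hqC)
      have hqG : q ∈ G := hF q ⟨hp.1.trans_le hq.1, hqt.trans ht.2⟩ hqC.1 hqC.2
      rcases ae_Ioo_or_ae_not_of_forall_aenear (P := P) (a := q) (b := t) fun s hs => hnC s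
        fun hsC => absurd (hqmax ⟨hsC, hq.1.trans hs.1.le, hs.2.le⟩) (not_le.2 hs.1) with h | h
      · exact hr q hqG (t - q) (by linarith) (by rwa [add_sub_cancel])
      · refine not_ae_of_ae_not (max_lt hc hqt) (hcd.mono fun s hs hs' => hs ?_)
          (h.mono fun s hs hs' => hs ?_)
        · exact ⟨(le_max_left _ _).trans_lt hs'.1, hs'.2.trans hd⟩
        · exact ⟨(le_max_right _ _).trans_lt hs'.1, hs'.2⟩
    · exact hp1 htP
    · have hK : IsCompact (C ∩ Icc t p) := isCompact_Icc.inter_left hCc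
      obtain ⟨q, ⟨hqC, hq⟩, hqmin⟩ := hK.exists_isLeast ⟨p, hpC, hpt.le, le_rfl⟩
      have hqt : t < q := lt_of_le_of_ne hq.1 fun h => htC (h ▸ hqC)
      have hqG : q ∈ G := hF q ⟨ht.1.trans hqt, hq.2.trans_lt hp.2⟩ hqC.1 hqC.2
      rcases ae_Ioo_or_ae_not_of_forall_aenear (P := P) (a := t) (b := q) fun s hs => hnC s
        fun hsC => absurd (hqmin ⟨hsC, hs.1.le, hs.2.le.trans hq.2⟩) (not_le.2 hs.2) with h | h
      · exact hl q hqG (q - t) (by linarith) (by rwa [sub_sub_cancel])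
      · refine not_ae_of_ae_not (lt_min hd hqt) (hcd.mono fun s hs hs' => hs ?_)
          (h.mono fun s hs hs' => hs ?_)
        · exact ⟨hc.trans hs'.1, hs'.2.trans_le (min_le_left _ _)⟩
        · exact ⟨hs'.1, hs'.2.trans_le (min_le_right _ _)⟩
  have hall : ∀ᵐ t : ℝ, t ∈ Ioo a b → ¬ P t := by
    have h1 : ∀ᵐ t : ℝ, t ∈ Ioo a b ∩ {t | AENear (fun s => ¬ P s) t} → ¬ P t := by
      rw [ae_iff]
      refine measure_null_of_locally_null _ fun t ht => ?_
      simp only [mem_ofPred_eq, Classical.not_imp] at ht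
      obtain ⟨c, d, hc, hd, hcd⟩ := ht.1.2
      refine ⟨_, inter_mem (mem_nhdsWithin_of_mem_nhds (Ioo_mem_nhds hc hd))
        self_mem_nhdsWithin, measure_mono_null ?_ (ae_iff.1 hcd)⟩
      rintro s ⟨hs1, hs2⟩ hs3
      exact hs2 fun _ => hs3 hs1
    filter_upwards [h1, hG] with t ht1 ht2 ht
    by_cases h : AENear (fun s => ¬ P s) t
    · exact ht1 ⟨ht, h⟩
    · exact ht2 (hF t ht (hno t ht) h)
  exact hp2 ⟨a, b, hp.1, hp.2, hall⟩

theorem ae_Ioo_or_ae_not_of_subset_iUnion {P : ℝ → Prop} {g h : ℕ → Set ℝ}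
    (hgc : ∀ k, IsClosed (g k)) (hhc : ∀ k, IsClosed (h k))
    (hg : ∀ᵐ t : ℝ, (∃ k, t ∈ g k) → ¬ P t) (hh : ∀ᵐ t : ℝ, (∃ k, t ∈ h k) → P t)
    (hgr : ∀ k, ∀ t ∈ g k, ∀ δ > 0, ¬ ∀ᵐ s : ℝ, s ∈ Ioo t (t + δ) → P s)
    (hgl : ∀ k, ∀ t ∈ g k, ∀ δ > 0, ¬ ∀ᵐ s : ℝ, s ∈ Ioo (t - δ) t → P s)
    (hhr : ∀ k, ∀ t ∈ h k, ∀ δ > 0, ¬ ∀ᵐ s : ℝ, s ∈ Ioo t (t + δ) → ¬ P s)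
    (hhl : ∀ k, ∀ t ∈ h k, ∀ δ > 0, ¬ ∀ᵐ s : ℝ, s ∈ Ioo (t - δ) t → ¬ P s) {a b : ℝ}
    (hcov : ∀ t ∈ Ioo a b, (∃ k, t ∈ g k) ∨ ∃ k, t ∈ h k) :
    (∀ᵐ t : ℝ, t ∈ Ioo a b → P t) ∨ ∀ᵐ t : ℝ, t ∈ Ioo a b → ¬ P t := by
  refine ae_Ioo_or_ae_not_of_forall_aenear ?_
  by_contra! hcon
  obtain ⟨p, hp, hp1, hp2⟩ := hcon
  set F : Set ℝ := Ioo a b ∩ ({t | AENear P t}ᶜ ∩ {t | AENear (fun s => ¬ P s) t}ᶜ) with hF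
  have hFl : IsLocallyClosed F := isOpen_Ioo.isLocallyClosed.inter
    ((isOpen_aenear _).isClosed_compl.inter (isOpen_aenear _).isClosed_compl).isLocallyClosed
  have : LocallyCompactSpace F := hFl.locallyCompactSpace
  have : Nonempty F := ⟨p, hp, hp1, hp2⟩
  have hc : ∀ i : ℕ ⊕ ℕ, IsClosed ((↑) ⁻¹' (Sum.elim g h i) : Set F) := by
    rintro (k | k)
    · exact (hgc k).preimage continuous_subtype_val
    · exact (hhc k).preimage continuous_subtype_val
  obtain ⟨i, ⟨x, hxF⟩, hx⟩ := nonempty_interior_of_iUnion_of_closed hc (by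
    rw [eq_univ_iff_forall]
    rintro ⟨x, hx⟩
    rw [mem_iUnion]
    rcases hcov x hx.1 with ⟨k, hk⟩ | ⟨k, hk⟩
    · exact ⟨Sum.inl k, hk⟩
    · exact ⟨Sum.inr k, hk⟩)
  rw [mem_interior_iff_mem_nhds, nhds_subtype_eq_comap, mem_comap] at hx
  obtain ⟨V, hV, hVs⟩ := hx
  obtain ⟨α, β, hxαβ, hαβ⟩ := mem_nhds_iff_exists_Ioo_subset.1
    (inter_mem hV (Ioo_mem_nhds hxF.1.1 hxF.1.2))
  have hsub : ∀ t ∈ Ioo α β, ¬ AENear P t → ¬ AENear (fun s => ¬ P s) t →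
      t ∈ Sum.elim g h i := fun t ht h1 h2 =>
    hVs (a := ⟨t, (hαβ ht).2, h1, h2⟩) (hαβ ht).1
  rcases i with k | k
  · exact absurd (aenear_or_of_subset (hg.mono fun t ht htk => ht ⟨k, htk⟩) (hgr k) (hgl k) hsub
      x hxαβ) (not_or.2 hxF.2)
  · have := aenear_or_of_subset (P := fun t => ¬ P t) (hh.mono fun t ht htk => not_not.2 (ht ⟨k, htk⟩))
      (hhr k) (hhl k) (a := α) (b := β) (fun t ht h1 h2 => hsub t ht (by simpa using h2) h1) x hxαβ
    simp only [not_not] at this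
    exact absurd this.symm (not_or.2 hxF.2)

/-- The line through `x` in direction `v` is regular for `E` on the side of sparse points: almost
all of its points where `E` is thin lie outside `E`, and none of them has a forward
neighbourhood on the line that is full of `E`. -/
def ThinRegular (d : ℕ) (E : Set (Euc d)) (v x : Euc d) : Prop :=
  (∀ᵐ t : ℝ, (∃ k, x + t • v ∈ thin d E (thinConst d) k) → x + t • v ∉ E) ∧
  ¬ ∃ t : ℝ, (∃ k, x + t • v ∈ thin d E (thinConst d) k) ∧
      ∃ δ > 0, ∀ᵐ s : ℝ, s ∈ Ioo 0 δ → x + t • v + s • v ∈ E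

theorem ThinRegular.add_smul {d : ℕ} {E : Set (Euc d)} {v x : Euc d} (h : ThinRegular d E v x)
    (a : ℝ) : ThinRegular d E v (x + a • v) := by
  have key : ∀ t : ℝ, x + a • v + t • v = x + (t + a) • v := fun t => by module
  refine ⟨?_, ?_⟩
  · simp only [key]
    exact (measurePreserving_add_right (volume : Measure ℝ) a).quasiMeasurePreserving.ae h.1
  · rintro ⟨t, ht⟩
    rw [key] at ht
    exact h.2 ⟨t + a, ht⟩

theorem measurableSet_thin_inter {d : ℕ} {E : Set (Euc d)} (hE : MeasurableSet E) :
    MeasurableSet {y : Euc d | (∃ k, y ∈ thin d E (thinConst d) k) ∧ y ∈ E} := by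
  have : {y : Euc d | (∃ k, y ∈ thin d E (thinConst d) k) ∧ y ∈ E} =
      (⋃ k, thin d E (thinConst d) k) ∩ E := by
    ext; simp
  rw [this]
  exact (MeasurableSet.iUnion fun k => (isClosed_thin d E _ k).measurableSet).inter hE

theorem ae_thinRegular {d : ℕ} {E : Set (Euc d)} (hE : MeasurableSet E) {v : Euc d}
    (hv : v ≠ 0) : ∀ᵐ x : Euc d, ThinRegular d E v x := by
  have h1 : ∀ᵐ y : Euc d, y ∈ {y : Euc d | (∃ k, y ∈ thin d E (thinConst d) k) ∧ y ∈ E}ᶜ := by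
    have := ae_notMem_thin d E (thinConst_lt_one d)
    rw [ae_restrict_iff' hE] at this
    filter_upwards [this] with y hy
    rintro ⟨⟨k, hk⟩, hyE⟩
    exact hy hyE k hk
  rw [← ae_ae_add_linearMap_mem_iff (LinearMap.toSpanSingleton ℝ (Euc d) v)
      (volume : Measure ℝ) volume (measurableSet_thin_inter hE).compl] at h1
  have h2 := measure_eq_zero_iff_ae_notMem.1 (volume_lines_through_thin hE hv)
  filter_upwards [h1, h2] with x hx1 hx2
  refine ⟨?_, hx2⟩
  filter_upwards [hx1] with t ht h h'
  exact ht ⟨h, h'⟩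

/-- The line through `x` in direction `v` is regular for slicing `E`. -/
def SliceRegular (d : ℕ) (E : Set (Euc d)) (v x : Euc d) : Prop :=
  (ThinRegular d E v x ∧ ThinRegular d E (-v) x) ∧
    ThinRegular d Eᶜ v x ∧ ThinRegular d Eᶜ (-v) x

theorem SliceRegular.add_smul {d : ℕ} {E : Set (Euc d)} {v x : Euc d} (h : SliceRegular d E v x)
    (a : ℝ) : SliceRegular d E v (x + a • v) := by
  have key : x + a • v = x + (-a) • (-v) := by module
  refine ⟨⟨h.1.1.add_smul a, ?_⟩, h.2.1.add_smul a, ?_⟩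
  · rw [key]; exact h.1.2.add_smul _
  · rw [key]; exact h.2.2.add_smul _

theorem ae_sliceRegular {d : ℕ} {E : Set (Euc d)} (hE : MeasurableSet E) {v : Euc d}
    (hv : v ≠ 0) : ∀ᵐ x : Euc d, SliceRegular d E v x :=
  ((ae_thinRegular hE hv).and (ae_thinRegular hE (neg_ne_zero.2 hv))).and
    ((ae_thinRegular hE.compl hv).and (ae_thinRegular hE.compl (neg_ne_zero.2 hv)))

theorem ThinRegular.forward {d : ℕ} {E : Set (Euc d)} {v x : Euc d} (h : ThinRegular d E v x)
    {k : ℕ} {t : ℝ} (ht : x + t • v ∈ thin d E (thinConst d) k) {δ : ℝ} (hδ : 0 < δ) :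
    ¬ ∀ᵐ s : ℝ, s ∈ Ioo t (t + δ) → x + s • v ∈ E := by
  intro hs
  refine h.2 ⟨t, ⟨k, ht⟩, δ, hδ, ?_⟩
  have := (measurePreserving_add_right (volume : Measure ℝ) t).quasiMeasurePreserving.ae hs
  filter_upwards [this] with s hs hs'
  have := hs ⟨by linarith [hs'.1], by linarith [hs'.2]⟩
  convert this using 1
  module

theorem ThinRegular.backward {d : ℕ} {E : Set (Euc d)} {v x : Euc d} (h : ThinRegular d E (-v) x)
    {k : ℕ} {t : ℝ} (ht : x + t • v ∈ thin d E (thinConst d) k) {δ : ℝ} (hδ : 0 < δ) :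
    ¬ ∀ᵐ s : ℝ, s ∈ Ioo (t - δ) t → x + s • v ∈ E := by
  intro hs
  have ht' : x + (-t) • (-v) ∈ thin d E (thinConst d) k := by
    convert ht using 1
    module
  refine h.forward ht' hδ ?_
  have := (Measure.measurePreserving_neg (volume : Measure ℝ)).quasiMeasurePreserving.ae hs
  filter_upwards [this] with s hs hs'
  have := hs ⟨by linarith [hs'.2], by linarith [hs'.1]⟩
  convert this using 1
  module

theorem SliceRegular.exists_mem_mBoundary {d : ℕ} {E : Set (Euc d)} {v x : Euc d}
    (h : SliceRegular d E v x) {k : ℕ} (hx : x ∈ thin d E (thinConst d) k) {T : ℝ} (hT : 0 < T)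
    (hE : ¬ ∀ᵐ t : ℝ, t ∈ Ioo 0 T → x + t • v ∉ E) :
    ∃ t ∈ Ioo 0 T, x + t • v ∈ mBoundary d E := by
  by_contra! hno
  have hcont : Continuous fun t : ℝ => x + t • v := by fun_prop
  have hx' : x + (0 : ℝ) • v ∈ thin d E (thinConst d) k := by simpa using hx
  rcases ae_Ioo_or_ae_not_of_subset_iUnion (P := fun t : ℝ => x + t • v ∈ E) (a := 0) (b := T)
    (g := fun k => (fun t : ℝ => x + t • v) ⁻¹' thin d E (thinConst d) k)
    (h := fun k => (fun t : ℝ => x + t • v) ⁻¹' thin d Eᶜ (thinConst d) k)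
    (fun k => (isClosed_thin _ _ _ _).preimage hcont)
    (fun k => (isClosed_thin _ _ _ _).preimage hcont) h.1.1.1
    (h.2.1.1.mono fun t ht h => not_not.1 (ht h))
    (fun k t ht δ hδ => h.1.1.forward ht hδ) (fun k t ht δ hδ => h.1.2.backward ht hδ)
    (fun k t ht δ hδ => h.2.1.forward ht hδ) (fun k t ht δ hδ => h.2.2.backward ht hδ)
    (fun t ht => by
      have := hno t ht
      rw [mBoundary, mem_inter_iff, not_and_or] at this
      exact this.imp (exists_mem_thin_of_notMem_mClosure (thinConst_ne_zero d))
        (exists_mem_thin_of_notMem_mClosure (thinConst_ne_zero d))) with h1 | h1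
  · refine h.1.1.forward hx' hT ?_
    rwa [zero_add]
  · exact hE h1

/-- The parametrization of the hyperplane `{y | y i = c}`, moved by the isometry `r · + u`. -/
def chart {n : ℕ} (r : Euc (n + 1) ≃ₗᵢ[ℝ] Euc (n + 1)) (u : Euc (n + 1)) (i : Fin (n + 1)) (c : ℝ)
    (z : Fin n → ℝ) : Euc (n + 1) :=
  r (WithLp.toLp 2 (i.insertNth c z : Fin (n + 1) → ℝ)) + u

/-- The time needed to reach `b` from the hyperplane `range (chart r u i c)` with velocity `v`. -/
def flightTime {n : ℕ} (r : Euc (n + 1) ≃ₗᵢ[ℝ] Euc (n + 1)) (u : Euc (n + 1)) (i : Fin (n + 1))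
    (c : ℝ) (v b : Euc (n + 1)) : ℝ :=
  (r.symm (b - u) i - c) / r.symm v i

/-- The chart coordinates of the projection of `b` along `v` to `range (chart r u i c)`. -/
def footCoord {n : ℕ} (r : Euc (n + 1) ≃ₗᵢ[ℝ] Euc (n + 1)) (u : Euc (n + 1)) (i : Fin (n + 1))
    (c : ℝ) (v b : Euc (n + 1)) (j : Fin n) : ℝ :=
  r.symm (b - u) (i.succAbove j) - flightTime r u i c v b * r.symm v (i.succAbove j)

section chart

variable {n : ℕ} (r : Euc (n + 1) ≃ₗᵢ[ℝ] Euc (n + 1)) (u : Euc (n + 1)) (i : Fin (n + 1)) (c : ℝ)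

theorem symm_chart_sub (z : Fin n → ℝ) :
    r.symm (chart r u i c z - u) = WithLp.toLp 2 (i.insertNth c z : Fin (n + 1) → ℝ) := by
  simp [chart]

theorem chart_eq_of_symm {x : Euc (n + 1)} (hx : r.symm (x - u) i = c) :
    chart r u i c (fun j => r.symm (x - u) (i.succAbove j)) = x := by
  have : WithLp.toLp 2 (i.insertNth c (fun j => r.symm (x - u) (i.succAbove j)) :
      Fin (n + 1) → ℝ) = r.symm (x - u) := by
    ext j
    refine Fin.succAboveCases i ?_ (fun j => ?_) j
    · simp only [Fin.insertNth_apply_same, hx]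
    · simp only [Fin.insertNth_apply_succAbove]
  rw [chart, this]
  simp

theorem lipschitzWith_chart : LipschitzWith ((n + 1 : ℕ) : ℝ≥0) (chart r u i c) := by
  refine LipschitzWith.of_dist_le_mul fun z z' => ?_
  rw [chart, chart, dist_add_right, r.dist_map, EuclideanSpace.dist_eq]
  refine Real.sqrt_le_iff.2 ⟨by positivity, ?_⟩
  have h : ∀ j : Fin (n + 1), dist ((i.insertNth c z : Fin (n + 1) → ℝ) j)
      ((i.insertNth c z' : Fin (n + 1) → ℝ) j) ^ 2 ≤ dist z z' ^ 2 := by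
    intro j
    gcongr
    refine Fin.succAboveCases i ?_ (fun j => ?_) j
    · simp
    · simpa using dist_le_pi_dist z z' j
  refine (Finset.sum_le_sum fun j _ => h j).trans ?_
  simp only [Finset.sum_const, Finset.card_univ, Fintype.card_fin, nsmul_eq_mul, mul_pow,
    NNReal.coe_natCast]
  gcongr
  have : (1 : ℝ) ≤ ((n + 1 : ℕ) : ℝ) := by exact_mod_cast Nat.succ_pos n
  nlinarith

theorem hausdorffMeasure_le_volume_chart_preimage {X : Set (Euc (n + 1))}
    (hX : X ⊆ range (chart r u i c)) :
    μH[(n : ℝ)] X ≤ ((n + 1 : ℕ) : ℝ≥0∞) ^ n * volume (chart r u i c ⁻¹' X) := by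
  have h := (lipschitzWith_chart r u i c).hausdorffMeasure_image_le (Nat.cast_nonneg n)
    (chart r u i c ⁻¹' X)
  have h2 : (μH[(n : ℝ)] : Measure (Fin n → ℝ)) = volume := by
    simpa using hausdorffMeasure_pi_real (ι := Fin n)
  rw [image_preimage_eq_of_subset hX, h2, ENNReal.rpow_natCast] at h
  simpa using h

variable {v : Euc (n + 1)}

theorem chart_footCoord_add (hv : r.symm v i ≠ 0) (b : Euc (n + 1)) :
    chart r u i c (footCoord r u i c v b) + flightTime r u i c v b • v = b := by
  have hx : r.symm ((b - flightTime r u i c v b • v) - u) =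
      r.symm (b - u) - flightTime r u i c v b • r.symm v := by
    rw [sub_right_comm, map_sub, map_smul]
  have h1 : r.symm ((b - flightTime r u i c v b • v) - u) i = c := by
    rw [hx]
    simp only [PiLp.sub_apply, PiLp.smul_apply, smul_eq_mul, flightTime]
    field_simp
    ring
  have h2 := chart_eq_of_symm r u i c h1
  have h3 : footCoord r u i c v b =
      fun j => r.symm ((b - flightTime r u i c v b • v) - u) (i.succAbove j) := by
    ext j
    rw [hx]
    simp [footCoord]
  rw [h3, h2, sub_add_cancel]

theorem flightTime_chart_add (hv : r.symm v i ≠ 0) (z : Fin n → ℝ) (t : ℝ) :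
    flightTime r u i c v (chart r u i c z + t • v) = t := by
  have : r.symm (chart r u i c z + t • v - u) =
      WithLp.toLp 2 (i.insertNth c z : Fin (n + 1) → ℝ) + t • r.symm v := by
    rw [add_sub_right_comm, map_add, symm_chart_sub, map_smul]
  rw [flightTime, this]
  simp only [PiLp.add_apply, PiLp.smul_apply, Fin.insertNth_apply_same, smul_eq_mul]
  field_simp
  ring

theorem footCoord_chart_add (hv : r.symm v i ≠ 0) (z : Fin n → ℝ) (t : ℝ) :
    footCoord r u i c v (chart r u i c z + t • v) = z := by
  have : r.symm (chart r u i c z + t • v - u) =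
      WithLp.toLp 2 (i.insertNth c z : Fin (n + 1) → ℝ) + t • r.symm v := by
    rw [add_sub_right_comm, map_add, symm_chart_sub, map_smul]
  ext j
  rw [footCoord, flightTime_chart_add r u i c hv, this]
  simp

theorem continuous_flightTime : Continuous (flightTime r u i c v) := by
  unfold flightTime
  fun_prop

theorem continuous_footCoord : Continuous (footCoord r u i c v) := by
  refine continuous_pi fun j => ?_
  have := continuous_flightTime r u i c (v := v)
  unfold footCoord
  fun_prop

theorem lipschitzWith_footCoord {κ : ℝ≥0} (hκ : 0 < κ) (hv1 : ‖v‖ ≤ 1)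
    (hv : κ ≤ |r.symm v i|) : LipschitzWith (1 + κ⁻¹) (footCoord r u i c v) := by
  refine LipschitzWith.of_dist_le_mul fun b b' => ?_
  refine (dist_pi_le_iff (by positivity)).2 fun j => ?_
  have hcoord : ∀ (y : Euc (n + 1)) (k : Fin (n + 1)), |r.symm y k| ≤ ‖y‖ := by
    intro y k
    rw [← r.symm.norm_map y, ← Real.norm_eq_abs]
    exact PiLp.norm_apply_le _ _
  have hlin : ∀ k, r.symm (b - u) k - r.symm (b' - u) k = r.symm (b - b') k := by
    intro k
    rw [← PiLp.sub_apply, ← map_sub, sub_sub_sub_cancel_right]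
  have hκ' : (0 : ℝ) < κ := hκ
  have h1 : footCoord r u i c v b j - footCoord r u i c v b' j =
      r.symm (b - b') (i.succAbove j) -
        r.symm (b - b') i / r.symm v i * r.symm v (i.succAbove j) := by
    rw [← hlin, ← hlin]
    simp only [footCoord, flightTime]
    ring
  rw [Real.dist_eq, h1, dist_eq_norm]
  refine (abs_sub _ _).trans ?_
  rw [abs_mul, abs_div]
  have h2 := hcoord (b - b') (i.succAbove j)
  have h3 := hcoord (b - b') i
  have h4 := (hcoord v (i.succAbove j)).trans hv1
  have h5 : |r.symm (b - b') i| / |r.symm v i| ≤ ‖b - b'‖ * (κ : ℝ)⁻¹ := by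
    rw [div_eq_mul_inv]
    gcongr
  have h6 : |r.symm (b - b') i| / |r.symm v i| * |r.symm v (i.succAbove j)| ≤
      ‖b - b'‖ * (κ : ℝ)⁻¹ * 1 := by gcongr
  push_cast
  linarith

theorem volume_footCoord_image_le {κ : ℝ≥0} (hκ : 0 < κ) (hv1 : ‖v‖ ≤ 1)
    (hv : κ ≤ |r.symm v i|) (A : Set (Euc (n + 1))) :
    volume (footCoord r u i c v '' A) ≤ ((1 + κ⁻¹ : ℝ≥0) : ℝ≥0∞) ^ n * μH[(n : ℝ)] A := by
  have h := (lipschitzWith_footCoord r u i c hκ hv1 hv).hausdorffMeasure_image_le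
    (Nat.cast_nonneg n) A
  have h2 : (μH[(n : ℝ)] : Measure (Fin n → ℝ)) = volume := by
    simpa using hausdorffMeasure_pi_real (ι := Fin n)
  rwa [h2, ENNReal.rpow_natCast] at h

theorem ae_chart_of_ae {p : Euc (n + 1) → Prop} (hp : ∀ᵐ x, p x)
    (hinv : ∀ x (a : ℝ), p x → p (x + a • v)) (hv : r.symm v i ≠ 0) :
    ∀ᵐ z, p (chart r u i c z) := by
  let L : ℝ × (Fin n → ℝ) →ₗ[ℝ] Euc (n + 1) :=
    { toFun := fun q => chart r 0 i 0 q.2 + q.1 • v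
      map_add' := by
        intro q q'
        have : chart r 0 i 0 (q.2 + q'.2) = chart r 0 i 0 q.2 + chart r 0 i 0 q'.2 := by
          simp only [chart, add_zero, ← map_add]
          congr 1
          ext j
          refine Fin.succAboveCases i ?_ (fun j => ?_) j <;> simp
        simp only [Prod.fst_add, Prod.snd_add, this]
        module
      map_smul' := by
        intro a q
        have : chart r 0 i 0 (a • q.2) = a • chart r 0 i 0 q.2 := by
          simp only [chart, add_zero, ← map_smul]
          congr 1
          ext j
          refine Fin.succAboveCases i ?_ (fun j => ?_) j <;> simp
        simp only [Prod.smul_fst, Prod.smul_snd, this, RingHom.id_apply]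
        module }
  have hL : Function.Surjective L := fun b => ⟨(_, _), chart_footCoord_add r 0 i 0 hv b⟩
  have hchart : ∀ z, chart r u i c z = chart r 0 i 0 z + chart r u i c 0 := by
    intro z
    simp only [chart, add_zero, ← add_assoc, ← map_add]
    congr 2
    ext j
    refine Fin.succAboveCases i ?_ (fun j => ?_) j <;> simp
  have hp' : ∀ᵐ y, p (y + chart r u i c 0) :=
    (measurePreserving_add_right (volume : Measure (Euc (n + 1)))
      (chart r u i c 0)).quasiMeasurePreserving.ae hp
  set N := toMeasurable volume {y | ¬ p (y + chart r u i c 0)} with hN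
  have hNm : MeasurableSet Nᶜ := (measurableSet_toMeasurable _ _).compl
  have hN0 : ∀ᵐ y, y ∈ Nᶜ := by
    rw [ae_iff]
    simp only [mem_compl_iff, not_not]
    change volume N = 0
    rw [hN, measure_toMeasurable]
    exact hp'
  have h1 := (ae_comp_linearMap_mem_iff L ((volume : Measure ℝ).prod (volume : Measure (Fin n → ℝ)))
    volume hL hNm).2 hN0
  have h2 : ((volume : Measure ℝ).prod (volume : Measure (Fin n → ℝ))) ((univ : Set ℝ) ×ˢ {z | ¬ p (chart r u i c z)}) = 0 := by
    refine measure_mono_null ?_ (ae_iff.1 h1)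
    rintro ⟨t, z⟩ ⟨-, hz⟩
    simp only [mem_ofPred_eq, mem_compl_iff, not_not]
    refine subset_toMeasurable _ _ ?_
    intro hpz
    refine hz ?_
    have := hinv _ (-t) hpz
    have he : L (t, z) + chart r u i c 0 + -t • v = chart r u i c z := by
      rw [hchart z]
      change chart r 0 i 0 z + t • v + chart r u i c 0 + -t • v = _
      module
    rwa [he] at this
  rw [Measure.prod_prod] at h2
  rw [ae_iff]
  simpa using h2

end chart

/-- The ray from `x` with velocity `v` meets `A` in positive length. -/
def Sees {d : ℕ} (A : Set (Euc d)) (x v : Euc d) : Prop :=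
  ¬ ∀ᵐ t : ℝ, 0 < t → x + t • v ∉ A

theorem measurableSet_sees {d : ℕ} {A : Set (Euc d)} (hA : MeasurableSet A) :
    MeasurableSet {p : Euc d × Euc d | Sees A p.1 p.2} := by
  have hf : Measurable fun q : (Euc d × Euc d) × ℝ => q.1.1 + q.2 • q.1.2 := by fun_prop
  have hM : MeasurableSet {q : (Euc d × Euc d) × ℝ | 0 < q.2 ∧ q.1.1 + q.2 • q.1.2 ∈ A} :=
    (measurable_snd measurableSet_Ioi).inter (hf hA)
  have h := measurable_measure_prodMk_left (ν := (volume : Measure ℝ)) hM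
  have h0 := h (measurableSet_singleton (0 : ℝ≥0∞)).compl
  convert h0 using 1
  ext p
  simp only [Sees, ae_iff, mem_ofPred_eq, mem_preimage, mem_compl_iff, mem_singleton_iff]
  simp only [Classical.not_imp, not_not]
  rfl

theorem sees_smul_iff {d : ℕ} {A : Set (Euc d)} {x v : Euc d} {a : ℝ} (ha : 0 < a) :
    Sees A x (a • v) ↔ Sees A x v := by
  have key : ∀ {b : ℝ} {w : Euc d}, 0 < b → (∀ᵐ t : ℝ, 0 < t → x + t • w ∉ A) →
      ∀ᵐ t : ℝ, 0 < t → x + t • (b • w) ∉ A := by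
    intro b w hb h
    have := (Measure.quasiMeasurePreserving_smul (volume : Measure ℝ) hb.ne').ae h
    filter_upwards [this] with t ht ht0
    have := ht (by positivity)
    rwa [smul_eq_mul, mul_comm, mul_smul] at this
  refine not_congr ⟨fun h => ?_, key ha⟩
  have := key (inv_pos.2 ha) h
  simpa [smul_smul, ha.ne'] using this

theorem volume_le_volume_sees {d : ℕ} {A : Set (Euc d)} (hA : MeasurableSet A) {x : Euc d}
    {R : ℝ} (hR : 0 < R) (hAR : A ⊆ closedBall x R) :
    volume A ≤ ENNReal.ofReal (R ^ d) * volume (closedBall 0 1 ∩ {v | Sees A x v}) := by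
  set B : Set (Euc d) := {v | ¬ Sees A x v} with hB
  have hBm : MeasurableSet B :=
    (measurable_prodMk_left (measurableSet_sees hA) : MeasurableSet {v | Sees A x v}).compl
  have hM : MeasurableSet {q : Euc d × ℝ | ¬ (q.1 ∈ B ∧ 0 < q.2 ∧ x + q.2 • q.1 ∈ A)} := by
    have hf : Measurable fun q : Euc d × ℝ => x + q.2 • q.1 := by fun_prop
    exact ((measurable_fst hBm).inter ((measurable_snd measurableSet_Ioi).inter (hf hA))).compl
  have h1 : ∀ᵐ v : Euc d, ∀ᵐ t : ℝ, ¬ (v ∈ B ∧ 0 < t ∧ x + t • v ∈ A) := by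
    refine Eventually.of_forall fun v => ?_
    by_cases hv : v ∈ B
    · have hv' : ∀ᵐ t : ℝ, 0 < t → x + t • v ∉ A := not_not.1 hv
      filter_upwards [hv'] with t ht h
      exact ht h.2.1 h.2.2
    · exact Eventually.of_forall fun t h => hv h.1
  rw [Measure.ae_ae_comm hM] at h1
  obtain ⟨t, ht0, ht⟩ : ∃ t : ℝ, 0 < t ∧ ∀ᵐ v : Euc d, ¬ (v ∈ B ∧ 0 < t ∧ x + t • v ∈ A) := by
    by_contra! hno
    have : volume (Ioi (0 : ℝ)) = 0 := measure_mono_null (fun t ht => hno t ht) (ae_iff.1 h1)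
    simp at this
  have hN : volume {w : Euc d | w ∈ B ∧ x + R • w ∈ A} = 0 := by
    have ha : 0 < t / R := by positivity
    have := Measure.addHaar_preimage_smul (volume : Measure (Euc d)) ha.ne'
      {w : Euc d | w ∈ B ∧ x + R • w ∈ A}
    have h0 : volume ((fun v : Euc d => (t / R) • v) ⁻¹' {w : Euc d | w ∈ B ∧ x + R • w ∈ A}) = 0 := by
      refine measure_mono_null ?_ (ae_iff.1 ht)
      rintro v ⟨hv1, hv2⟩
      simp only [mem_ofPred_eq, not_not]
      refine ⟨fun h => hv1 ((sees_smul_iff ha).2 h), ht0, ?_⟩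
      rwa [smul_smul, mul_div_cancel₀ _ hR.ne'] at hv2
    rw [h0] at this
    have := this.symm
    rw [mul_eq_zero] at this
    refine this.resolve_left ?_
    rw [ENNReal.ofReal_eq_zero, not_le]
    positivity
  have hA' : volume A = ENNReal.ofReal (R ^ d) * volume {w : Euc d | x + R • w ∈ A} := by
    have h2 := Measure.addHaar_preimage_smul (volume : Measure (Euc d)) hR.ne' ((x + ·) ⁻¹' A)
    rw [measure_preimage_add, finrank_euclideanSpace_fin] at h2
    change volume {w : Euc d | x + R • w ∈ A} = _ at h2
    rw [h2, ← mul_assoc, abs_of_pos (by positivity), ← ENNReal.ofReal_mul (by positivity),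
      mul_inv_cancel₀ (by positivity), ENNReal.ofReal_one, one_mul]
  rw [hA']
  gcongr 1
  calc volume {w : Euc d | x + R • w ∈ A}
      ≤ volume ((closedBall 0 1 ∩ {v | Sees A x v}) ∪ {w : Euc d | w ∈ B ∧ x + R • w ∈ A}) := by
        refine measure_mono fun w hw => ?_
        by_cases hwB : w ∈ B
        · exact Or.inr ⟨hwB, hw⟩
        · refine Or.inl ⟨?_, not_not.1 hwB⟩
          have := hAR hw
          rw [mem_closedBall, dist_eq_norm, add_sub_cancel_left, norm_smul, Real.norm_eq_abs,
            abs_of_pos hR] at this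
          rw [mem_closedBall_zero_iff]
          exact le_of_mul_le_mul_left (by linarith) hR
    _ ≤ _ := (measure_union_le _ _).trans (by rw [hN, add_zero])

theorem exists_volume_slab_le (d : ℕ) {η : ℝ≥0∞} (hη : 0 < η) :
    ∃ κ : ℝ≥0, 0 < κ ∧ ∀ i : Fin d, volume (closedBall (0 : Euc d) 1 ∩ {v | |v i| < κ}) ≤ η := by
  have hone : ∀ i : Fin d, ∀ᶠ κ : ℝ≥0 in 𝓝[>] 0,
      volume (closedBall (0 : Euc d) 1 ∩ {v | |v i| < κ}) ≤ η := by
    intro i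
    have hm : ∀ κ : ℝ≥0, MeasurableSet (closedBall (0 : Euc d) 1 ∩ {v | |v i| < κ}) := by
      intro κ
      have : Measurable fun v : Euc d => |v i| := by fun_prop
      exact measurableSet_closedBall.inter (this measurableSet_Iio)
    have hlim := tendsto_measure_biInter_gt (μ := (volume : Measure (Euc d)))
      (s := fun κ : ℝ≥0 => closedBall (0 : Euc d) 1 ∩ {v | |v i| < κ}) (a := 0)
      (fun κ _ => (hm κ).nullMeasurableSet)
      (fun κ κ' _ hk v hv => ⟨hv.1, lt_of_lt_of_le (b := (κ : ℝ)) hv.2 (NNReal.coe_le_coe.2 hk)⟩)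
      ⟨1, one_pos, (measure_mono_top inter_subset_left).mt measure_closedBall_lt_top.ne⟩
    have h0 : volume (⋂ κ : ℝ≥0, ⋂ (_ : κ > 0), closedBall (0 : Euc d) 1 ∩ {v | |v i| < κ}) = 0 := by
      refine measure_mono_null (t := {v : Euc d | v i = 0}) ?_ ?_
      · intro v hv
        simp only [mem_iInter] at hv
        by_contra hne
        have := (hv ⟨|v i|, abs_nonneg _⟩ (abs_pos.2 hne)).2
        exact lt_irrefl |v i| this
      · have := Measure.addHaar_submodule (volume : Measure (Euc d))
          (LinearMap.ker (EuclideanSpace.proj i : Euc d →L[ℝ] ℝ).toLinearMap) ?_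
        · exact this
        · intro htop
          have : EuclideanSpace.single i (1 : ℝ) ∈
              LinearMap.ker (EuclideanSpace.proj i : Euc d →L[ℝ] ℝ).toLinearMap := by
            rw [htop]; trivial
          simp at this
    rw [h0] at hlim
    exact (hlim.eventually (gt_mem_nhds hη)).mono fun _ h => h.le
  obtain ⟨κ, h, hκ⟩ := ((eventually_all.2 hone).and self_mem_nhdsWithin).exists
  exact ⟨κ, hκ, h⟩

theorem exists_half_le_volume_transversal (d : ℕ) {η : ℝ≥0∞} (hη : 0 < η) (hη' : η ≠ ⊤) :
    ∃ κ : ℝ≥0, 0 < κ ∧ ∀ (r : Euc d ≃ₗᵢ[ℝ] Euc d) (i : Fin d) (G : Set (Euc d)),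
      η ≤ volume (closedBall 0 1 ∩ G) →
      η / 2 ≤ volume (closedBall 0 1 ∩ G ∩ {v | κ ≤ |r.symm v i|}) := by
  obtain ⟨κ, hκ, h⟩ := exists_volume_slab_le d (ENNReal.half_pos hη.ne')
  refine ⟨κ, hκ, fun r i G hG => ?_⟩
  have hm : MeasurableSet (closedBall (0 : Euc d) 1 ∩ {v | |v i| < κ}) := by
    have : Measurable fun v : Euc d => |v i| := by fun_prop
    exact measurableSet_closedBall.inter (this measurableSet_Iio)
  have hr : volume (closedBall (0 : Euc d) 1 ∩ {v | |r.symm v i| < κ}) ≤ η / 2 := by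
    have := r.symm.measurePreserving.measure_preimage hm.nullMeasurableSet
    refine le_trans (le_of_eq ?_) (h i)
    rw [← this]
    congr 1
    ext v
    simp
  have hle : η ≤ volume (closedBall 0 1 ∩ G ∩ {v | κ ≤ |r.symm v i|}) + η / 2 := by
    refine hG.trans ((measure_mono ?_).trans ((measure_union_le _ _).trans (add_le_add_right hr _)))
    intro v hv
    rcases le_or_gt (κ : ℝ) |r.symm v i| with hv' | hv'
    · exact Or.inl ⟨hv, hv'⟩
    · exact Or.inr ⟨hv.1, hv'⟩
  have h2 : η / 2 ≠ ⊤ := ENNReal.div_ne_top hη' (by norm_num)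
  rw [← ENNReal.add_halves η] at hle
  have hle' : η / 2 + η / 2 ≤ volume (closedBall 0 1 ∩ G ∩ {v | κ ≤ |r.symm v i|}) + η / 2 := by
    simpa [ENNReal.add_halves] using hle
  exact (ENNReal.add_le_add_iff_right h2).1 hle'

/-- The cube with side length `l` in the coordinates `r.symm (· - u)`. -/
def coordCube {d : ℕ} (r : Euc d ≃ₗᵢ[ℝ] Euc d) (u : Euc d) (l : ℝ) : Set (Euc d) :=
  {x | ∀ i, r.symm (x - u) i ∈ Ioo 0 l}

theorem IsCubeOfSide.exists_eq_coordCube {d : ℕ} {l : ℝ} {Q : Set (Euc d)}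
    (h : IsCubeOfSide d l Q) : ∃ r u, Q = coordCube r u l := by
  obtain ⟨hl, r, u, rfl⟩ := h
  refine ⟨r, u, ?_⟩
  ext x
  simp only [mem_image, mem_ofPred_eq, coordCube, mem_Ioo]
  constructor
  · rintro ⟨y, hy, rfl⟩ i
    have := hy i
    simp only [add_sub_cancel_right, map_smul, LinearIsometryEquiv.symm_apply_apply,
      PiLp.smul_apply, smul_eq_mul]
    exact ⟨mul_pos hl this.1, mul_lt_of_lt_one_right hl this.2⟩
  · intro hx
    refine ⟨l⁻¹ • r.symm (x - u), fun i => ?_, ?_⟩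
    · simp only [PiLp.smul_apply, smul_eq_mul]
      refine ⟨mul_pos (inv_pos.2 hl) (hx i).1, ?_⟩
      rw [inv_mul_lt_iff₀ hl, mul_one]
      exact (hx i).2
    · rw [map_smul, smul_smul, mul_inv_cancel₀ hl.ne', one_smul,
        LinearIsometryEquiv.apply_symm_apply, sub_add_cancel]

section coordCube

variable {d : ℕ} (r : Euc d ≃ₗᵢ[ℝ] Euc d) (u : Euc d) {l : ℝ}

theorem isOpen_coordCube : IsOpen (coordCube r u l) := by
  have : coordCube r u l = ⋂ i, {x | r.symm (x - u) i ∈ Ioo 0 l} := by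
    ext; simp [coordCube]
  rw [this]
  refine isOpen_iInter_of_finite fun i => ?_
  exact isOpen_Ioo.preimage (f := fun x : Euc d => r.symm (x - u) i) (by fun_prop)

theorem convex_coordCube : Convex ℝ (coordCube r u l) := by
  intro x hx y hy a b ha hb hab i
  have : r.symm (a • x + b • y - u) i = a • r.symm (x - u) i + b • r.symm (y - u) i := by
    have h : a • x + b • y - u = a • (x - u) + b • (y - u) := by
      have : u = (a + b) • u := by rw [hab, one_smul]
      nth_rewrite 1 [this]
      module
    rw [h, map_add, map_smul, map_smul]
    rfl
  rw [this]
  exact convex_Ioo 0 l (hx i) (hy i) ha hb hab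

theorem closure_coordCube_subset :
    closure (coordCube r u l) ⊆ {x | ∀ i, r.symm (x - u) i ∈ Icc 0 l} := by
  refine closure_minimal (fun x hx i => Ioo_subset_Icc_self (hx i)) ?_
  have : {x : Euc d | ∀ i, r.symm (x - u) i ∈ Icc 0 l} =
      ⋂ i, {x | r.symm (x - u) i ∈ Icc 0 l} := by
    ext; simp
  rw [this]
  refine isClosed_iInter fun i => ?_
  exact isClosed_Icc.preimage (f := fun x : Euc d => r.symm (x - u) i) (by fun_prop)

theorem exists_face_of_mem_closure {x : Euc d} (hx : x ∈ closure (coordCube r u l))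
    (hx' : x ∉ coordCube r u l) : ∃ i, r.symm (x - u) i = 0 ∨ r.symm (x - u) i = l := by
  have h := closure_coordCube_subset r u hx
  by_contra! hno
  exact hx' fun i => ⟨lt_of_le_of_ne (h i).1 (hno i).1.symm, lt_of_le_of_ne (h i).2 (hno i).2⟩

theorem volume_coordCube (hl : 0 < l) : volume (coordCube r u l) = ENNReal.ofReal (l ^ d) := by
  have h1 : coordCube r u l = (fun x => x - u) ⁻¹' (r.symm ⁻¹'
      (WithLp.ofLp ⁻¹' (Set.univ.pi fun _ : Fin d => Ioo 0 l))) := by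
    ext; simp [coordCube]
  have hm : MeasurableSet (Set.univ.pi fun _ : Fin d => Ioo 0 l) :=
    MeasurableSet.univ_pi fun _ => measurableSet_Ioo
  have hm' := (PiLp.volume_preserving_ofLp (Fin d)).measurable hm
  rw [h1, (measurePreserving_sub_right _ u).measure_preimage
      (r.symm.continuous.measurable hm').nullMeasurableSet,
    r.symm.measurePreserving.measure_preimage hm'.nullMeasurableSet,
    (PiLp.volume_preserving_ofLp (Fin d)).measure_preimage hm.nullMeasurableSet,
    Real.volume_pi_Ioo]
  simp [ENNReal.ofReal_pow hl.le]

theorem coordCube_subset_closedBall (hl : 0 < l) {x : Euc d}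
    (hx : x ∈ closure (coordCube r u l)) : coordCube r u l ⊆ closedBall x (d * l) := by
  intro y hy
  have h := closure_coordCube_subset r u hx
  rw [mem_closedBall, ← r.symm.dist_map, ← dist_sub_right _ _ (r.symm u), ← map_sub, ← map_sub,
    EuclideanSpace.dist_eq]
  refine Real.sqrt_le_iff.2 ⟨by positivity, ?_⟩
  have hi : ∀ i, dist (r.symm (y - u) i) (r.symm (x - u) i) ^ 2 ≤ l ^ 2 := by
    intro i
    gcongr
    have h1 := hy i
    have h2 := h i
    rw [Real.dist_eq, abs_le]
    constructor <;> linarith [h1.1, h1.2, h2.1, h2.2]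
  refine (Finset.sum_le_sum fun i _ => hi i).trans ?_
  simp only [Finset.sum_const, Finset.card_univ, Fintype.card_fin, nsmul_eq_mul, mul_pow]
  gcongr
  rcases Nat.eq_zero_or_pos d with rfl | hd
  · simp
  · have : (1 : ℝ) ≤ d := by exact_mod_cast hd
    nlinarith

end coordCube

theorem Sees.exists_time {d : ℕ} {E Q : Set (Euc d)} (hQ : IsOpen Q) {x v : Euc d}
    (h : Sees (E ∩ Q) x v) :
    ∃ T : ℝ, 0 < T ∧ x + T • v ∈ Q ∧ ¬ ∀ᵐ t : ℝ, t ∈ Ioo 0 T → x + t • v ∉ E := by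
  by_contra! hno
  refine h ?_
  rw [ae_iff]
  refine measure_null_of_locally_null _ fun t ht => ?_
  simp only [mem_ofPred_eq, Classical.not_imp, not_not] at ht
  have hcont : Continuous fun t : ℝ => x + t • v := by fun_prop
  obtain ⟨δ, hδ, hball⟩ := Metric.isOpen_iff.1 (hQ.preimage hcont) t ht.2.2
  have hT : x + (t + δ / 2) • v ∈ Q := by
    refine hball (show t + δ / 2 ∈ ball t δ from ?_)
    rw [mem_ball, Real.dist_eq, add_sub_cancel_left, abs_of_pos (by positivity)]
    linarith
  have h0 := hno (t + δ / 2) (by linarith [ht.1]) hT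
  refine ⟨{s | ¬ (0 < s → x + s • v ∉ E ∩ Q)} ∩ Ioo 0 (t + δ / 2),
    inter_mem_nhdsWithin _ (Ioo_mem_nhds ht.1 (by linarith)), ?_⟩
  refine measure_mono_null ?_ (ae_iff.1 h0)
  rintro s ⟨hs1, hs2⟩
  simp only [mem_ofPred_eq, Classical.not_imp, not_not] at hs1 ⊢
  exact ⟨hs2, hs1.2.1⟩

theorem add_smul_mem_of_mem_closure {d : ℕ} {Q : Set (Euc d)} (hQ : IsOpen Q) (hQc : Convex ℝ Q)
    {x v : Euc d} (hx : x ∈ closure Q) {T : ℝ} (hT : x + T • v ∈ Q) {t : ℝ} (ht : t ∈ Ioo 0 T) :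
    x + t • v ∈ Q := by
  have h := hQc.openSegment_closure_interior_subset_interior hx (hQ.interior_eq.symm ▸ hT)
  rw [hQ.interior_eq] at h
  have hT0 : 0 < T := ht.1.trans ht.2
  refine h ⟨1 - t / T, t / T, ?_, ?_, by ring, ?_⟩
  · rw [sub_pos, div_lt_one hT0]; exact ht.2
  · exact div_pos ht.1 hT0
  · have : t • v = (t / T) • T • v := by rw [smul_smul, div_mul_cancel₀ _ hT0.ne']
    rw [this]
    module

/-- The points of `Q` reached with velocity `v` from the part `X` of the hyperplane
`range (chart r u i c)`. -/
def shadow {n : ℕ} (r : Euc (n + 1) ≃ₗᵢ[ℝ] Euc (n + 1)) (u : Euc (n + 1)) (i : Fin (n + 1)) (c : ℝ)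
    (Q X : Set (Euc (n + 1))) (v : Euc (n + 1)) : Set (Euc (n + 1)) :=
  {b | b ∈ Q ∧ chart r u i c (footCoord r u i c v b) ∈ X ∧ 0 < flightTime r u i c v b}

section shadow

variable {n : ℕ} {r : Euc (n + 1) ≃ₗᵢ[ℝ] Euc (n + 1)} {u : Euc (n + 1)} {i : Fin (n + 1)} {c : ℝ}
  {Q X : Set (Euc (n + 1))} {v : Euc (n + 1)}

theorem measurableSet_shadow (hQ : MeasurableSet Q) (hX : MeasurableSet X) :
    MeasurableSet (shadow r u i c Q X v) := by
  have h1 := ((lipschitzWith_chart r u i c).continuous.comp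
    (continuous_footCoord r u i c (v := v))).measurable hX
  have h2 := (continuous_flightTime r u i c (v := v)).measurable (measurableSet_Ioi (a := (0 : ℝ)))
  exact hQ.inter (h1.inter h2)

theorem volume_sees_le {E : Set (Euc (n + 1))} (hE : MeasurableSet E) (hQ : IsOpen Q)
    (hQc : Convex ℝ Q) (hXQ : X ⊆ closure Q)
    (hXE : ∀ x ∈ X, ∃ k, x ∈ thin (n + 1) E (thinConst (n + 1)) k)
    {κ : ℝ≥0} (hκ : 0 < κ) (hv1 : ‖v‖ ≤ 1) (hv : κ ≤ |r.symm v i|) :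
    volume {z | chart r u i c z ∈ X ∧ Sees (E ∩ Q) (chart r u i c z) v} ≤
      ((1 + κ⁻¹ : ℝ≥0) : ℝ≥0∞) ^ n * μH[(n : ℝ)] (mBoundary (n + 1) E ∩ shadow r u i c Q X v) := by
  have hvi : r.symm v i ≠ 0 := abs_pos.1 (lt_of_lt_of_le (NNReal.coe_pos.2 hκ) hv)
  have hv0 : v ≠ 0 := by
    rintro rfl
    simp at hvi
  refine le_trans (measure_mono_ae ?_) (volume_footCoord_image_le r u i c hκ hv1 hv _)
  filter_upwards [ae_chart_of_ae r u i c (ae_sliceRegular hE hv0) (fun x a h => h.add_smul a) hvi]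
    with z hz hzX
  obtain ⟨hzX, hsee⟩ := hzX
  obtain ⟨T, hT, hTQ, hTE⟩ := hsee.exists_time hQ
  obtain ⟨k, hk⟩ := hXE _ hzX
  obtain ⟨t, ht, hb⟩ := hz.exists_mem_mBoundary hk hT hTE
  have hft := footCoord_chart_add r u i c hvi z t
  refine ⟨_, ⟨hb, add_smul_mem_of_mem_closure hQ hQc (hXQ hzX) hTQ ht, ?_, ?_⟩, hft⟩
  · rwa [hft]
  · rw [flightTime_chart_add r u i c hvi]
    exact ht.1

theorem disjoint_shadow {r' : Euc (n + 1) ≃ₗᵢ[ℝ] Euc (n + 1)} {u' : Euc (n + 1)} {i' : Fin (n + 1)}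
    {c' : ℝ} {Q' X' : Set (Euc (n + 1))} (hQ : IsOpen Q) (hQc : Convex ℝ Q) (hXQ : X ⊆ closure Q)
    (hQ' : IsOpen Q') (hQc' : Convex ℝ Q') (hXQ' : X' ⊆ closure Q') (hX : Disjoint X X')
    (hXQd : Disjoint X Q') (hXQd' : Disjoint X' Q) (hv : r.symm v i ≠ 0)
    (hv' : r'.symm v i' ≠ 0) :
    Disjoint (shadow r u i c Q X v) (shadow r' u' i' c' Q' X' v) := by
  rw [Set.disjoint_left]
  rintro b ⟨hbQ, hbX, hs⟩ ⟨hbQ', hbX', hs'⟩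
  have hx := chart_footCoord_add r u i c hv b
  have hx' := chart_footCoord_add r' u' i' c' hv' b
  set x := chart r u i c (footCoord r u i c v b)
  set x' := chart r' u' i' c' (footCoord r' u' i' c' v b)
  set s := flightTime r u i c v b
  set s' := flightTime r' u' i' c' v b
  have hd : x' = x + (s - s') • v := by
    have : x' = x + s • v - s' • v := by rw [hx, ← hx', add_sub_cancel_right]
    rw [this]
    module
  rcases lt_trichotomy s s' with h | h | h
  · refine Set.disjoint_left.1 hXQd hbX ?_
    have hd' : x = x' + (s' - s) • v := by rw [hd]; module
    rw [hd']
    exact add_smul_mem_of_mem_closure hQ' hQc' (hXQ' hbX') (hx'.symm ▸ hbQ')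
      ⟨by linarith, by linarith⟩
  · refine Set.disjoint_left.1 hX hbX ?_
    rw [h, sub_self, zero_smul, add_zero] at hd
    rwa [← hd]
  · refine Set.disjoint_left.1 hXQd' hbX' ?_
    rw [hd]
    exact add_smul_mem_of_mem_closure hQ hQc (hXQ hbX) (hx.symm ▸ hbQ)
      ⟨by linarith, by linarith⟩

end shadow

theorem sum_measure_inter_le {α ι : Type*} [MeasurableSpace α] (μ : Measure α) (s : Finset ι)
    {M : ι → Set α} (hM : ∀ j, MeasurableSet (M j)) (hd : (s : Set ι).PairwiseDisjoint M)
    (B : Set α) {U : Set α} (hU : ∀ j, M j ⊆ U) :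
    ∑ j ∈ s, μ (B ∩ M j) ≤ μ (B ∩ U) := by
  have : ∀ j, μ (B ∩ M j) = μ.restrict (B ∩ U) (M j) := fun j => by
    rw [Measure.restrict_apply (hM j)]
    congr 1
    ext x
    exact ⟨fun h => ⟨h.2, h.1, hU j h.2⟩, fun h => ⟨h.2.1, h.1⟩⟩
  simp only [this]
  rw [← measure_biUnion_finset hd fun j _ => hM j]
  exact (measure_mono (subset_univ _)).trans (by rw [Measure.restrict_apply_univ])

theorem exists_measurable_disjoint_refinement {α ι : Type*} [MeasurableSpace α] [Fintype ι]
    {W : ι → Set α} (hW : ∀ j, MeasurableSet (W j)) :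
    ∃ X : ι → Set α, (∀ j, X j ⊆ W j) ∧ (∀ j, MeasurableSet (X j)) ∧
      Pairwise (fun j k => Disjoint (X j) (X k)) ∧ ⋃ j, X j = ⋃ j, W j := by
  let e := Fintype.equivFin ι
  refine ⟨fun j => disjointed (W ∘ e.symm) (e j), fun j => ?_, fun j => ?_, fun j k hjk => ?_, ?_⟩
  · simpa using disjointed_le (W ∘ e.symm) (e j)
  · simp only [disjointed_apply, Finset.sup_set_eq_biUnion]
    exact (hW _).diff (Finset.measurableSet_biUnion _ fun k _ => hW _)
  · exact disjoint_disjointed _ (e.injective.ne hjk)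
  · rw [e.surjective.iUnion_comp (disjointed (W ∘ e.symm)), iUnion_disjointed]
    exact e.symm.surjective.iUnion_comp W

theorem sum_volume_chart_preimage_le {n : ℕ} {ι : Type*} [Fintype ι]
    {r : ι → Euc (n + 1) ≃ₗᵢ[ℝ] Euc (n + 1)} {u : ι → Euc (n + 1)} {i : ι → Fin (n + 1)}
    {c : ι → ℝ} {Q X : ι → Set (Euc (n + 1))} {E : Set (Euc (n + 1))} (hE : MeasurableSet E)
    (hQ : ∀ j, IsOpen (Q j)) (hQc : ∀ j, Convex ℝ (Q j)) (hX : ∀ j, MeasurableSet (X j))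
    (hXQ : ∀ j, X j ⊆ closure (Q j))
    (hXE : ∀ j, ∀ x ∈ X j, ∃ k, x ∈ thin (n + 1) E (thinConst (n + 1)) k)
    (hXd : Pairwise fun j k => Disjoint (X j) (X k)) (hXQd : ∀ j k, Disjoint (X j) (Q k))
    {η : ℝ≥0∞} {κ : ℝ≥0} (hκ : 0 < κ)
    (hη : ∀ j, ∀ x ∈ X j, η ≤ volume (closedBall 0 1 ∩ {v | Sees (E ∩ Q j) x v} ∩
      {v | κ ≤ |(r j).symm v (i j)|})) :
    η * ∑ j, volume (chart (r j) (u j) (i j) (c j) ⁻¹' X j) ≤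
      volume (closedBall (0 : Euc (n + 1)) 1) *
        (((1 + κ⁻¹ : ℝ≥0) : ℝ≥0∞) ^ n * μH[(n : ℝ)] (mBoundary (n + 1) E ∩ ⋃ j, Q j)) := by
  set K := ((1 + κ⁻¹ : ℝ≥0) : ℝ≥0∞) ^ n * μH[(n : ℝ)] (mBoundary (n + 1) E ∩ ⋃ j, Q j)
  let S : ι → Set ((Fin n → ℝ) × Euc (n + 1)) := fun j =>
    {p | chart (r j) (u j) (i j) (c j) p.1 ∈ X j ∧ p.2 ∈ closedBall 0 1 ∧
      Sees (E ∩ Q j) (chart (r j) (u j) (i j) (c j) p.1) p.2 ∧ κ ≤ |(r j).symm p.2 (i j)|}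
  have hchart : ∀ j, Measurable (chart (r j) (u j) (i j) (c j)) := fun j =>
    (lipschitzWith_chart _ _ _ _).continuous.measurable
  have hS : ∀ j, MeasurableSet (S j) := by
    intro j
    have h1 : MeasurableSet {p : (Fin n → ℝ) × Euc (n + 1) |
        chart (r j) (u j) (i j) (c j) p.1 ∈ X j} := ((hchart j).comp measurable_fst) (hX j)
    have h2 : MeasurableSet {p : (Fin n → ℝ) × Euc (n + 1) | p.2 ∈ closedBall 0 1} :=
      measurable_snd measurableSet_closedBall
    have h3 : MeasurableSet {p : (Fin n → ℝ) × Euc (n + 1) |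
        Sees (E ∩ Q j) (chart (r j) (u j) (i j) (c j) p.1) p.2} :=
      (((hchart j).comp measurable_fst).prodMk measurable_snd)
        (measurableSet_sees (hE.inter (hQ j).measurableSet))
    have h4 : MeasurableSet {p : (Fin n → ℝ) × Euc (n + 1) | κ ≤ |(r j).symm p.2 (i j)|} := by
      have : Measurable fun p : (Fin n → ℝ) × Euc (n + 1) => |(r j).symm p.2 (i j)| := by
        fun_prop
      exact this measurableSet_Ici
    exact h1.inter (h2.inter (h3.inter h4))
  have hlow : ∀ j, η * volume (chart (r j) (u j) (i j) (c j) ⁻¹' X j) ≤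
      ∫⁻ v, volume ((fun z => (z, v)) ⁻¹' S j) := by
    intro j
    rw [← Measure.prod_apply_symm (μ := (volume : Measure (Fin n → ℝ))) (hS j),
      Measure.prod_apply (hS j), ← setLIntegral_const]
    refine (setLIntegral_mono' (hchart j (hX j)) fun z hz => ?_).trans
      (setLIntegral_le_lintegral _ _)
    refine (hη j _ hz).trans (measure_mono ?_)
    rintro v ⟨⟨hv1, hv2⟩, hv3⟩
    exact ⟨hz, hv1, hv2, hv3⟩
  have hup : ∀ v, ∑ j, volume ((fun z => (z, v)) ⁻¹' S j) ≤
      (closedBall (0 : Euc (n + 1)) 1).indicator (fun _ => K) v := by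
    intro v
    by_cases hv : v ∈ closedBall (0 : Euc (n + 1)) 1
    · rw [indicator_of_mem hv]
      classical
      have hv1 : ‖v‖ ≤ 1 := mem_closedBall_zero_iff.1 hv
      set J : Finset ι := Finset.univ.filter fun j => (κ : ℝ) ≤ |(r j).symm v (i j)| with hJ
      have hvi : ∀ j ∈ J, (r j).symm v (i j) ≠ 0 := fun j hj =>
        abs_pos.1 (lt_of_lt_of_le (NNReal.coe_pos.2 hκ) (Finset.mem_filter.1 hj).2)
      have h0 : ∑ j, volume ((fun z => (z, v)) ⁻¹' S j) =
          ∑ j ∈ J, volume ((fun z => (z, v)) ⁻¹' S j) := by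
        refine (Finset.sum_subset (Finset.subset_univ _) fun j _ hj => ?_).symm
        refine measure_mono_null (t := ∅) (fun z hz => hj ?_) measure_empty
        exact Finset.mem_filter.2 ⟨Finset.mem_univ _, hz.2.2.2⟩
      rw [h0]
      calc ∑ j ∈ J, volume ((fun z => (z, v)) ⁻¹' S j)
          ≤ ∑ j ∈ J, ((1 + κ⁻¹ : ℝ≥0) : ℝ≥0∞) ^ n * μH[(n : ℝ)] (mBoundary (n + 1) E ∩
              shadow (r j) (u j) (i j) (c j) (Q j) (X j) v) := by
            refine Finset.sum_le_sum fun j hj => ?_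
            refine (measure_mono ?_).trans (volume_sees_le (u := u j) (c := c j) hE (hQ j) (hQc j)
              (hXQ j) (hXE j) hκ hv1 (Finset.mem_filter.1 hj).2)
            exact fun z hz => ⟨hz.1, hz.2.2.1⟩
        _ ≤ K := by
            rw [← Finset.mul_sum]
            refine mul_le_mul' le_rfl ?_
            refine sum_measure_inter_le _ J
              (fun j => measurableSet_shadow (hQ j).measurableSet (hX j)) ?_ _
              (fun j b hb => mem_iUnion.2 ⟨j, hb.1⟩)
            intro j hj k hk hjk
            exact disjoint_shadow (hQ j) (hQc j) (hXQ j) (hQ k) (hQc k) (hXQ k) (hXd hjk)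
              (hXQd j k) (hXQd k j) (hvi j hj) (hvi k hk)
    · rw [indicator_of_notMem hv]
      refine (Finset.sum_eq_zero fun j _ => ?_).le
      exact measure_mono_null (t := ∅) (fun z hz => hv hz.2.1) measure_empty
  calc η * ∑ j, volume (chart (r j) (u j) (i j) (c j) ⁻¹' X j)
      ≤ ∑ j, ∫⁻ v, volume ((fun z => (z, v)) ⁻¹' S j) := by
        rw [Finset.mul_sum]
        exact Finset.sum_le_sum fun j _ => hlow j
    _ = ∫⁻ v, ∑ j, volume ((fun z => (z, v)) ⁻¹' S j) :=
        (lintegral_finsetSum _ fun j _ => measurable_measure_prodMk_right (hS j)).symm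
    _ ≤ ∫⁻ v, (closedBall (0 : Euc (n + 1)) 1).indicator (fun _ => K) v := lintegral_mono hup
    _ = volume (closedBall (0 : Euc (n + 1)) 1) * K := by
        rw [lintegral_indicator_const measurableSet_closedBall, mul_comm]

theorem exists_hausdorffMeasure_frontier_diff_le (n : ℕ) {ε : ℝ} (hε : 0 < ε) :
    ∃ C : ℝ≥0∞, C ≠ ⊤ ∧ ∀ E : Set (Euc (n + 1)), MeasurableSet E →
      ∀ 𝒬 : Finset (Set (Euc (n + 1))),
        (∀ Q ∈ 𝒬, IsCube (n + 1) Q ∧ ENNReal.ofReal ε * volume Q < volume (E ∩ Q)) →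
        μH[(n : ℝ)] (frontier (⋃₀ ↑𝒬) \ mClosure (n + 1) E) ≤
          C * μH[(n : ℝ)] (mBoundary (n + 1) E ∩ ⋃₀ ↑𝒬) := by
  set η : ℝ≥0∞ := ENNReal.ofReal (ε / ((n + 1 : ℕ) : ℝ) ^ (n + 1)) with hη
  have hη0 : 0 < η := ENNReal.ofReal_pos.2 (by positivity)
  obtain ⟨κ, hκ, hκ'⟩ := exists_half_le_volume_transversal (n + 1) hη0 ENNReal.ofReal_ne_top
  refine ⟨((n + 1 : ℕ) : ℝ≥0∞) ^ n * ((η / 2)⁻¹ * (volume (closedBall (0 : Euc (n + 1)) 1) *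
    ((1 + κ⁻¹ : ℝ≥0) : ℝ≥0∞) ^ n)), ?_, ?_⟩
  · refine ENNReal.mul_ne_top (by finiteness) (ENNReal.mul_ne_top ?_ (ENNReal.mul_ne_top
      measure_closedBall_lt_top.ne (by finiteness)))
    exact ENNReal.inv_ne_top.2 (ENNReal.half_pos hη0.ne').ne'
  intro E hE 𝒬 h𝒬
  have hcube : ∀ Q : 𝒬, ∃ (l : ℝ) (r : Euc (n + 1) ≃ₗᵢ[ℝ] Euc (n + 1)) (u : Euc (n + 1)),
      0 < l ∧ (Q : Set (Euc (n + 1))) = coordCube r u l := by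
    intro Q
    obtain ⟨l, hl⟩ := (h𝒬 Q Q.2).1
    obtain ⟨r, u, h⟩ := hl.exists_eq_coordCube
    exact ⟨l, r, u, hl.1, h⟩
  choose l r u hl hQ using hcube
  have hopen : ∀ Q : 𝒬, IsOpen (Q : Set (Euc (n + 1))) := fun Q => by
    rw [hQ]; exact isOpen_coordCube _ _
  have hconv : ∀ Q : 𝒬, Convex ℝ (Q : Set (Euc (n + 1))) := fun Q => by
    rw [hQ]; exact convex_coordCube _ _
  set U : Set (Euc (n + 1)) := ⋃₀ ↑𝒬 with hU
  have hUo : IsOpen U := isOpen_sUnion fun Q hQ => hopen ⟨Q, hQ⟩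
  let ι := 𝒬 × Fin (n + 1) × Bool
  let c : ι → ℝ := fun j => if j.2.2 then l j.1 else 0
  let W : ι → Set (Euc (n + 1)) := fun j => (closure (j.1 : Set (Euc (n + 1))) \ U) ∩
    ((⋃ k, thin (n + 1) E (thinConst (n + 1)) k) ∩ {x | (r j.1).symm (x - u j.1) j.2.1 = c j})
  have hWm : ∀ j, MeasurableSet (W j) := by
    intro j
    refine (isClosed_closure.measurableSet.diff hUo.measurableSet).inter
      ((MeasurableSet.iUnion fun k => (isClosed_thin _ _ _ k).measurableSet).inter ?_)
    have : Measurable fun x : Euc (n + 1) => (r j.1).symm (x - u j.1) j.2.1 := by fun_prop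
    exact this (measurableSet_singleton (c j))
  obtain ⟨X, hXW, hXm, hXd, hXU⟩ := exists_measurable_disjoint_refinement hWm
  have hcover : frontier U \ mClosure (n + 1) E ⊆ ⋃ j, X j := by
    rw [hXU]
    rintro x ⟨hx, hxE⟩
    rw [hUo.frontier_eq] at hx
    obtain ⟨hxc, hxU⟩ := hx
    have hxc' := hxc
    rw [hU, 𝒬.finite_toSet.closure_sUnion] at hxc'
    obtain ⟨Q, hQ𝒬, hxQ⟩ := mem_iUnion₂.1 hxc'
    have hxnQ : x ∉ Q := fun h => hxU ⟨Q, hQ𝒬, h⟩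
    have hQe := hQ ⟨Q, hQ𝒬⟩
    simp only at hQe
    have hxk := exists_mem_thin_of_notMem_mClosure (thinConst_ne_zero (n + 1)) hxE
    obtain ⟨i, hi⟩ := exists_face_of_mem_closure _ _ (hQe ▸ hxQ) (hQe ▸ hxnQ)
    rcases hi with hi | hi
    · exact mem_iUnion.2 ⟨(⟨Q, hQ𝒬⟩, i, false), ⟨hxQ, hxU⟩, mem_iUnion.2 hxk, hi⟩
    · exact mem_iUnion.2 ⟨(⟨Q, hQ𝒬⟩, i, true), ⟨hxQ, hxU⟩, mem_iUnion.2 hxk, hi⟩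
  have hlow : ∀ j : ι, ∀ x ∈ X j, η / 2 ≤ volume (closedBall 0 1 ∩
      {v | Sees (E ∩ (j.1 : Set (Euc (n + 1)))) x v} ∩
      {v | κ ≤ |(r j.1).symm v j.2.1|}) := by
    intro j x hx
    refine hκ' _ _ _ ?_
    have hxQ := (hXW j hx).1.1
    have hvol := (h𝒬 j.1 j.1.2).2
    have hR : 0 < ((n + 1 : ℕ) : ℝ) * l j.1 := mul_pos (by positivity) (hl j.1)
    have hsub : E ∩ (j.1 : Set (Euc (n + 1))) ⊆ closedBall x (((n + 1 : ℕ) : ℝ) * l j.1) := by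
      rw [hQ] at hxQ ⊢
      exact inter_subset_right.trans (coordCube_subset_closedBall _ _ (hl j.1) hxQ)
    have h1 := hvol.le.trans
      (volume_le_volume_sees (hE.inter (hopen j.1).measurableSet) hR hsub)
    have h2 : volume (j.1 : Set (Euc (n + 1))) = ENNReal.ofReal (l j.1 ^ (n + 1)) := by
      rw [hQ, volume_coordCube _ _ (hl j.1)]
    have hpos : 0 < (((n + 1 : ℕ) : ℝ) * l j.1) ^ (n + 1) := by positivity
    have h3 : ENNReal.ofReal ((((n + 1 : ℕ) : ℝ) * l j.1) ^ (n + 1)) * η =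
        ENNReal.ofReal ε * volume (j.1 : Set (Euc (n + 1))) := by
      rw [h2, hη, ← ENNReal.ofReal_mul hpos.le, ← ENNReal.ofReal_mul hε.le, mul_pow]
      congr 1
      field_simp
    rw [← h3] at h1
    exact (ENNReal.mul_le_mul_iff_right (ENNReal.ofReal_pos.2 hpos).ne' ENNReal.ofReal_ne_top).1 h1
  have hUQ : (⋃ j : ι, (j.1 : Set (Euc (n + 1)))) ⊆ U := by
    refine iUnion_subset fun j => subset_sUnion_of_mem j.1.2
  have hsum := sum_volume_chart_preimage_le (r := fun j : ι => r j.1) (u := fun j => u j.1)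
    (i := fun j => j.2.1) (c := c) (Q := fun j => (j.1 : Set (Euc (n + 1)))) (X := X) hE
    (fun j => hopen j.1) (fun j => hconv j.1) hXm (fun j x hx => (hXW j hx).1.1)
    (fun j x hx => mem_iUnion.1 (hXW j hx).2.1) hXd
    (fun j k => Set.disjoint_left.2 fun x hx hxk => (hXW j hx).1.2 ⟨_, k.1.2, hxk⟩) hκ hlow
  have hη2 : η / 2 ≠ 0 := (ENNReal.half_pos hη0.ne').ne'
  have hη2' : η / 2 ≠ ⊤ := ENNReal.div_ne_top ENNReal.ofReal_ne_top (by norm_num)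
  calc μH[(n : ℝ)] (frontier U \ mClosure (n + 1) E)
      ≤ ∑ j, μH[(n : ℝ)] (X j) := (measure_mono hcover).trans (measure_iUnion_fintype_le _ _)
    _ ≤ ∑ j : ι, ((n + 1 : ℕ) : ℝ≥0∞) ^ n *
          volume (chart (r j.1) (u j.1) j.2.1 (c j) ⁻¹' X j) :=
        Finset.sum_le_sum fun j _ => hausdorffMeasure_le_volume_chart_preimage _ _ _ _
          fun x hx => ⟨_, chart_eq_of_symm _ _ _ _ (hXW j hx).2.2⟩
    _ = ((n + 1 : ℕ) : ℝ≥0∞) ^ n * ((η / 2)⁻¹ * (η / 2 *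
          ∑ j : ι, volume (chart (r j.1) (u j.1) j.2.1 (c j) ⁻¹' X j))) := by
        rw [← Finset.mul_sum, ← mul_assoc (η / 2)⁻¹, ENNReal.inv_mul_cancel hη2 hη2', one_mul]
    _ ≤ ((n + 1 : ℕ) : ℝ≥0∞) ^ n * ((η / 2)⁻¹ * (volume (closedBall (0 : Euc (n + 1)) 1) *
          (((1 + κ⁻¹ : ℝ≥0) : ℝ≥0∞) ^ n * μH[(n : ℝ)] (mBoundary (n + 1) E ∩ U)))) := by
        have := hsum.trans (b := _) (c := volume (closedBall (0 : Euc (n + 1)) 1) *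
          (((1 + κ⁻¹ : ℝ≥0) : ℝ≥0∞) ^ n * μH[(n : ℝ)] (mBoundary (n + 1) E ∩ U))) (by gcongr)
        gcongr
    _ = _ := by simp only [mul_assoc]

/-- for `ε ∈ (0,1)`, a measurable set `E` of locally finite perimeter and
a finite set `𝒬` of cubes each satisfying `|E ∩ Q| > ε |Q|`, we have
`H^{d-1}(∂(⋃𝒬) \ cl* E) ≤ C_{d,ε} H^{d-1}(∂* E ∩ ⋃𝒬)`. -/
theorem stmt9 (d : ℕ) (hd : 1 ≤ d) (ε : ℝ) (hε : ε ∈ Set.Ioo (0:ℝ) 1) :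
    ∃ C : ℝ, 0 < C ∧
      ∀ (E : Set (Euc d)), MeasurableSet E → HasLocallyFinitePerimeter d E →
      ∀ (𝒬 : Finset (Set (Euc d))),
        (∀ Q ∈ 𝒬, IsCube d Q ∧ ENNReal.ofReal ε * volume Q < volume (E ∩ Q)) →
        μH[(d:ℝ)-1] (frontier (⋃₀ ↑𝒬) \ mClosure d E) ≤
          ENNReal.ofReal C * μH[(d:ℝ)-1] (mBoundary d E ∩ ⋃₀ ↑𝒬) := by
  obtain ⟨n, rfl⟩ := Nat.exists_eq_add_of_le' hd
  obtain ⟨C, hC, h⟩ := exists_hausdorffMeasure_frontier_diff_le n hε.1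
  refine ⟨C.toReal + 1, by positivity, fun E hE _ 𝒬 h𝒬 => ?_⟩
  have hn : ((n + 1 : ℕ) : ℝ) - 1 = n := by push_cast; ring
  rw [hn]
  refine (h E hE 𝒬 h𝒬).trans (mul_le_mul' ?_ le_rfl)
  calc C = ENNReal.ofReal C.toReal := (ENNReal.ofReal_toReal hC).symm
    _ ≤ _ := ENNReal.ofReal_le_ofReal (by linarith)
end
end

section
/- Let S be a set of cubes all of the same scale such that for any two distinct Q, R ∈ S one has |Q ∩ R| ≤ 2^{−1} min{|Q|, |R|}. Then for every constant C ≥ 1 and every point x ∈ ℝ^d, the number of cubes Q ∈ S with x ∈ CQ is bounded by a constant depending only on C and the dimension d. -/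
open MeasureTheory Metric Set Filter
open scoped ENNReal NNReal Topology

noncomputable section

/-- The open box `(a, b)^d` in Euclidean space. -/
def openBox (d : ℕ) (a b : ℝ) : Set (Euc d) := {x | ∀ i, x i ∈ Set.Ioo a b}

lemma volume_openBox (d : ℕ) (a b : ℝ) :
    volume (openBox d a b) = ENNReal.ofReal (b - a) ^ d := by
  have h : openBox d a b =
      (WithLp.ofLp : Euc d → Fin d → ℝ) ⁻¹' (Set.univ.pi fun _ => Set.Ioo a b) := by
    ext x; simp [openBox]
  rw [h, (PiLp.volume_preserving_ofLp (Fin d)).measure_preimage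
    (MeasurableSet.univ_pi fun _ => measurableSet_Ioo).nullMeasurableSet, Real.volume_pi_Ioo]
  simp

lemma volume_similarity_image {d : ℕ} {l : ℝ} (hl : 0 < l) (r : Euc d ≃ₗᵢ[ℝ] Euc d) (v : Euc d)
    (s : Set (Euc d)) :
    volume ((fun x => l • r x + v) '' s) = ENNReal.ofReal (l ^ d) * volume s := by
  have h : (fun x => l • r x + v) '' s = (fun x => x + v) '' ((fun x => l • x) '' (r '' s)) := by
    rw [Set.image_image, Set.image_image]
  rw [h, Set.image_add_right, measure_preimage_add_right, Set.image_smul,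
    Measure.addHaar_smul,
    finrank_euclideanSpace_fin, abs_of_pos (pow_pos hl d),
    r.image_eq_preimage_symm, r.symm.measurePreserving.measure_preimage_emb
      r.symm.toHomeomorph.measurableEmbedding]

lemma norm_le_of_mem_openBox {d : ℕ} {u : Euc d} (hu : u ∈ openBox d 0 1) : ‖u‖ ≤ √d := by
  rw [EuclideanSpace.norm_eq]
  apply Real.sqrt_le_sqrt
  calc ∑ i, ‖u i‖ ^ 2 ≤ ∑ _i : Fin d, (1 : ℝ) := by
        refine Finset.sum_le_sum fun i _ => ?_
        have := hu i
        rw [Real.norm_eq_abs, sq_abs]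
        nlinarith [this.1, this.2]
    _ = d := by simp

lemma cubeCenter_mem_closedBall {d : ℕ} {Q : Set (Euc d)} {v : Euc d} {ρ : ℝ}
    (h0 : volume Q ≠ 0) (hQ : Q ⊆ closedBall v ρ) (hm : MeasurableSet Q) :
    cubeCenter d Q ∈ closedBall v ρ := by
  have h : cubeCenter d Q = ⨍ x in Q, x := by
    rw [setAverage_eq]; rfl
  rw [h]
  refine (convex_closedBall v ρ).set_average_mem isClosed_closedBall h0
    ((measure_mono hQ).trans_lt measure_closedBall_lt_top).ne ?_ ?_
  · exact (ae_restrict_mem hm).mono fun x hx => hQ hx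
  · exact (continuousOn_id.integrableOn_compact (isCompact_closedBall v ρ)).mono_set hQ

lemma isOpen_openBox (d : ℕ) (a b : ℝ) : IsOpen (openBox d a b) := by
  have h : openBox d a b = ⋂ i, (fun x : Euc d => x i) ⁻¹' Set.Ioo a b := by
    ext x; simp [openBox]
  rw [h]
  exact isOpen_iInter_of_finite fun i => isOpen_Ioo.preimage (by fun_prop)

lemma similarity_image_eq_preimage {d : ℕ} {l : ℝ} (hl : 0 < l) (r : Euc d ≃ₗᵢ[ℝ] Euc d)
    (v : Euc d) (s : Set (Euc d)) :
    (fun x => l • r x + v) '' s = (fun y => r.symm (l⁻¹ • (y - v))) ⁻¹' s := by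
  refine congrFun (Set.image_eq_preimage_of_inverse ?_ ?_) s
  · intro x
    simp [hl.ne']
  · intro y
    simp [hl.ne']

lemma norm_sub_le_of_mem_dilate {d : ℕ} {C : ℝ} (hC : 1 ≤ C) {l : ℝ} (hl : 0 < l)
    (r : Euc d ≃ₗᵢ[ℝ] Euc d) (v x : Euc d)
    (hx : x ∈ dilate d C ((fun x => l • r x + v) '' openBox d 0 1)) :
    ‖v - x‖ ≤ (1 + 2 * C) * (l * √d) := by
  set Q := (fun x => l • r x + v) '' openBox d 0 1 with hQdef
  have hQ : Q ⊆ closedBall v (l * √d) := by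
    rintro _ ⟨u, hu, rfl⟩
    rw [mem_closedBall, dist_eq_norm, add_sub_cancel_right, norm_smul, r.norm_map,
      Real.norm_of_nonneg hl.le]
    exact mul_le_mul_of_nonneg_left (norm_le_of_mem_openBox hu) hl.le
  have h0 : volume Q ≠ 0 := by
    rw [hQdef, volume_similarity_image hl, volume_openBox]
    simp [pow_pos hl d]
  have hm : MeasurableSet Q := by
    rw [hQdef, similarity_image_eq_preimage hl]
    exact ((isOpen_openBox d 0 1).preimage (by fun_prop)).measurableSet
  have hc := cubeCenter_mem_closedBall h0 hQ hm
  obtain ⟨y, hy, rfl⟩ := hx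
  have hy := hQ hy
  set c := cubeCenter d Q
  rw [mem_closedBall, dist_eq_norm] at hc hy
  have e : v - (c + C • (y - c)) = -((c - v) + C • ((y - v) - (c - v))) := by
    rw [sub_sub_sub_cancel_right]; abel
  rw [e, norm_neg]
  calc _ ≤ ‖c - v‖ + C * (‖y - v‖ + ‖c - v‖) := by
        refine (norm_add_le _ _).trans ?_
        rw [norm_smul, Real.norm_of_nonneg (by linarith)]
        gcongr
        exact norm_sub_le _ _
    _ ≤ l * √d + C * (l * √d + l * √d) := by gcongr
    _ = _ := by ring

lemma half_volume_lt_volume_inter {d : ℕ} {l l' δ : ℝ} (hl : 0 < l) (hl' : 0 < l') (hδ : 0 ≤ δ)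
    (hd : 1 / 2 < (1 - 2 * δ) ^ d) (hδ' : 2 * δ ≤ 1)
    (r r' : Euc d ≃ₗᵢ[ℝ] Euc d) (v v' : Euc d)
    (h : ∀ u ∈ openBox d 0 1, ‖(l • r u + v) - (l' • r' u + v')‖ ≤ l' * δ) :
    volume ((fun x => l • r x + v) '' openBox d 0 1) / 2 <
      volume ((fun x => l • r x + v) '' openBox d 0 1 ∩
        (fun x => l' • r' x + v') '' openBox d 0 1) := by
  have hsub : openBox d δ (1 - δ) ⊆ openBox d 0 1 := fun u hu i =>
    ⟨hδ.trans_lt (hu i).1, by linarith [(hu i).2]⟩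
  have hinc : (fun x => l • r x + v) '' openBox d δ (1 - δ) ⊆
      (fun x => l • r x + v) '' openBox d 0 1 ∩
        (fun x => l' • r' x + v') '' openBox d 0 1 := by
    refine Set.subset_inter (Set.image_mono hsub) ?_
    rw [similarity_image_eq_preimage hl' r' v']
    rintro _ ⟨u, hu, rfl⟩ i
    set w := r'.symm (l'⁻¹ • (l • r u + v - v'))
    have hw : ‖w - u‖ ≤ δ := by
      have e : w - u = r'.symm (l'⁻¹ • ((l • r u + v) - (l' • r' u + v'))) := by
        rw [show (l • r u + v) - (l' • r' u + v') = (l • r u + v - v') - l' • r' u by abel,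
          smul_sub, smul_smul, inv_mul_cancel₀ hl'.ne', one_smul, map_sub,
          LinearIsometryEquiv.symm_apply_apply]
      rw [e, LinearIsometryEquiv.norm_map, norm_smul, norm_inv, Real.norm_of_nonneg hl'.le,
        inv_mul_le_iff₀ hl']
      exact h u (hsub hu)
    have hi : |w i - u i| ≤ δ := (PiLp.norm_apply_le (w - u) i).trans hw
    rw [abs_le] at hi
    exact ⟨by linarith [(hu i).1, hi.1], by linarith [(hu i).2, hi.2]⟩
  refine lt_of_lt_of_le ?_ (measure_mono hinc)
  rw [volume_similarity_image hl, volume_similarity_image hl, volume_openBox, volume_openBox,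
    sub_zero, ENNReal.ofReal_one, one_pow, mul_one,
    ← ENNReal.ofReal_pow (by linarith), ← ENNReal.ofReal_mul (by positivity), ← ENNReal.ofReal_ofNat,
    ← ENNReal.ofReal_div_of_pos two_pos]
  have hp := pow_pos hl d
  rw [show 1 - δ - δ = 1 - 2 * δ by ring]
  rw [ENNReal.ofReal_lt_ofReal_iff (by positivity)]
  nlinarith

lemma TotallyBounded.exists_card_bound {α : Type*} [PseudoMetricSpace α] [Nonempty α] {s : Set α}
    (hs : TotallyBounded s) {ε : ℝ} (hε : 0 < ε) :
    ∃ M : ℕ, ∀ {β : Type*} (T : Set β) (f : β → α), MapsTo f T s →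
      (∀ a ∈ T, ∀ b ∈ T, dist (f a) (f b) < ε → a = b) → T.Finite ∧ Nat.card T ≤ M := by
  obtain ⟨t, ht, hst⟩ := Metric.totallyBounded_iff.1 hs (ε / 2) (half_pos hε)
  refine ⟨t.ncard, fun {β} T f hf hsep => ?_⟩
  have hcov : ∀ a ∈ T, ∃ y ∈ t, dist (f a) y < ε / 2 := fun a ha => by
    simpa using hst (hf ha)
  choose! g hgt hg using hcov
  have hinj : InjOn g T := fun a ha b hb hab => hsep a ha b hb <| by
    have := hg b hb
    rw [← hab] at this
    linarith [dist_triangle_right (f a) (f b) (g a), hg a ha]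
  exact ⟨ht.of_injOn hgt hinj, by
    rw [Nat.card_coe_set_eq]; exact ncard_le_ncard_of_injOn g hgt hinj ht⟩

/-- if `S` is a set of cubes of the same scale `2^n` such that any two
distinct cubes in `S` overlap in at most half the measure of the smaller one, then for
any `C ≥ 1` and any point `x`, the number of cubes `Q ∈ S` with `x ∈ CQ` is bounded by
a constant depending only on `C` and `d`. -/
theorem stmt12 (d : ℕ) (hd : 1 ≤ d) (C : ℝ) (hC : 1 ≤ C) :
    ∃ M : ℕ, ∀ (S : Set (Set (Euc d))) (n : ℤ),
      (∀ Q ∈ S, ∃ l, IsCubeOfSide d l Q ∧ l ∈ Set.Ico ((2:ℝ)^n) ((2:ℝ)^(n+1))) →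
      (∀ Q ∈ S, ∀ R ∈ S, Q ≠ R → volume (Q ∩ R) ≤ min (volume Q) (volume R) / 2) →
      ∀ x : Euc d,
        {Q | Q ∈ S ∧ x ∈ dilate d C Q}.Finite ∧
        Nat.card {Q | Q ∈ S ∧ x ∈ dilate d C Q} ≤ M := by
  set δ : ℝ := 1 / (4 * (d + 1)) with hδ
  have hδ0 : 0 < δ := by positivity
  have hδd : δ * (4 * (d + 1)) = 1 := by rw [hδ]; field_simp
  have hδ1 : 2 * δ ≤ 1 := by
    have : 0 ≤ δ * d := by positivity
    linarith
  have hδp : 1 / 2 < (1 - 2 * δ) ^ d := by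
    have := one_add_mul_le_pow (a := -(2 * δ)) (by linarith) d
    rw [← sub_eq_add_neg] at this
    linarith
  set ε : ℝ := δ / (√d + 1) with hε
  have hε0 : 0 < ε := by positivity
  have hεd : ε * √d + ε = δ := by rw [hε]; field_simp
  obtain ⟨M, hM⟩ := (isCompact_closedBall (0 : (Euc d →L[ℝ] Euc d) × Euc d)
    (max 2 ((1 + 2 * C) * (2 * √d)))).totallyBounded.exists_card_bound hε0
  refine ⟨M, fun S n hS hdisj x => ?_⟩
  have hs : (0 : ℝ) < 2 ^ n := by positivity
  set s : ℝ := 2 ^ n with hsdef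
  have hs2 : (2 : ℝ) ^ (n + 1) = s * 2 := by rw [zpow_add₀ two_ne_zero, zpow_one]
  rw [hs2] at hS
  have hpar : ∀ Q ∈ S, ∃ (l : ℝ) (r : Euc d ≃ₗᵢ[ℝ] Euc d) (v : Euc d),
      s ≤ l ∧ l < s * 2 ∧ Q = (fun x => l • r x + v) '' openBox d 0 1 := by
    intro Q hQ
    obtain ⟨l, ⟨-, r, v, h⟩, h1, h2⟩ := hS Q hQ
    exact ⟨l, r, v, h1, h2, h⟩
  choose! l r v hl hl2 hQ using hpar
  refine hM {Q | Q ∈ S ∧ x ∈ dilate d C Q}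
    (fun Q => (s⁻¹ • l Q • ((r Q).toContinuousLinearEquiv : Euc d →L[ℝ] Euc d),
      s⁻¹ • (v Q - x))) ?_ ?_
  · rintro Q ⟨hQS, hxQ⟩
    have hl0 : 0 < l Q := hs.trans_le (hl Q hQS)
    rw [mem_closedBall_zero_iff, Prod.norm_def]
    refine max_le_max ?_ ?_
    · refine ContinuousLinearMap.opNorm_le_bound _ zero_le_two fun u => ?_
      simp only [smul_apply, norm_smul, norm_inv, Real.norm_of_nonneg hs.le,
        Real.norm_of_nonneg hl0.le, ContinuousLinearEquiv.coe_coe,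
        LinearIsometryEquiv.coe_toContinuousLinearEquiv, LinearIsometryEquiv.norm_map]
      rw [inv_mul_le_iff₀ hs, ← mul_assoc]
      exact mul_le_mul_of_nonneg_right (hl2 Q hQS).le (norm_nonneg u)
    · rw [hQ Q hQS] at hxQ
      have := norm_sub_le_of_mem_dilate hC hl0 (r Q) (v Q) x hxQ
      rw [norm_smul, norm_inv, Real.norm_of_nonneg hs.le, inv_mul_le_iff₀ hs]
      refine this.trans ?_
      calc (1 + 2 * C) * (l Q * √d) ≤ (1 + 2 * C) * (s * 2 * √d) := by
            gcongr
            exact (hl2 Q hQS).le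
        _ = _ := by ring
  · rintro Q ⟨hQS, -⟩ R ⟨hRS, -⟩ hdist
    by_contra hne
    have hlQ : 0 < l Q := hs.trans_le (hl Q hQS)
    have hlR : 0 < l R := hs.trans_le (hl R hRS)
    refine ((hdisj Q hQS R hRS hne).trans
      (ENNReal.div_le_div_right (min_le_left _ _) 2)).not_gt ?_
    rw [hQ Q hQS, hQ R hRS]
    refine half_volume_lt_volume_inter hlQ hlR hδ0.le hδp hδ1 _ _ _ _ fun u hu => ?_
    rw [Prod.dist_eq, max_lt_iff, dist_eq_norm, dist_eq_norm] at hdist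
    obtain ⟨hA, hb⟩ := hdist
    have hAu := ContinuousLinearMap.le_of_opNorm_le _ hA.le u
    have e : (l Q • r Q u + v Q) - (l R • r R u + v R) =
        s • ((s⁻¹ • l Q • r Q u - s⁻¹ • l R • r R u) +
          (s⁻¹ • (v Q - x) - s⁻¹ • (v R - x))) := by
      simp only [smul_add, smul_sub, smul_inv_smul₀ hs.ne']
      abel
    rw [e, norm_smul, Real.norm_of_nonneg hs.le]
    refine mul_le_mul (hl R hRS) ?_ (norm_nonneg _) hlR.le
    rw [← hεd]
    refine (norm_add_le _ _).trans (add_le_add (hAu.trans ?_) hb.le)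
    exact mul_le_mul_of_nonneg_left (norm_le_of_mem_openBox hu) hε0.le
end
end

section
/- Let Q0 ⊂ ℝ^d be a cube and let E ⊂ Q0 be a measurable set with |E ∩ Q0| < |Q0|/2. Then the union of the cubes Q ∈ Δ(Q0) satisfying 2^{−d−1} ≤ |E ∩ Q|/|Q| < 1/2 covers Lebesgue-almost all of E ∩ Q0. -/
open MeasureTheory Metric Set Filter
open scoped ENNReal NNReal Topology

noncomputable section

/-- The open dyadic cube of generation `n` with index `k`, in coordinates. -/
def dyadicBox (d n : ℕ) (k : Fin d → ℕ) : Set (Fin d → ℝ) :=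
  Set.pi univ fun i => Ioo ((k i : ℝ) / 2 ^ n) (((k i : ℝ) + 1) / 2 ^ n)

lemma volume_dyadicBox (d n : ℕ) (k : Fin d → ℕ) :
    volume (dyadicBox d n k) = ENNReal.ofReal ((1 / 2 ^ n) ^ d) := by
  rw [dyadicBox, Real.volume_pi_Ioo]
  have h : ∀ i, ((k i : ℝ) + 1) / 2 ^ n - (k i : ℝ) / 2 ^ n = 1 / 2 ^ n := fun i => by ring
  simp only [h, Finset.prod_const, Finset.card_univ, Fintype.card_fin]
  rw [ENNReal.ofReal_pow (by positivity)]

lemma dyadicBox_ae_eq_closedBall (d n : ℕ) (k : Fin d → ℕ) :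
    dyadicBox d n k =ᵐ[volume]
      closedBall (fun i => ((k i : ℝ) + 1 / 2) / 2 ^ n) (1 / 2 / 2 ^ n) := by
  have h : closedBall (fun i => ((k i : ℝ) + 1 / 2) / 2 ^ n) (1 / 2 / 2 ^ n) =
      Icc (fun i => (k i : ℝ) / 2 ^ n) (fun i => ((k i : ℝ) + 1) / 2 ^ n) := by
    rw [closedBall_pi _ (by positivity), ← pi_univ_Icc]
    congr 1
    funext i
    rw [Real.closedBall_eq_Icc]
    congr 1 <;> ring
  rw [h]
  exact Measure.univ_pi_Ioo_ae_eq_Icc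

/-- The index of the dyadic cube of generation `n` containing `x`. -/
def dyadicIndex (d : ℕ) (x : Fin d → ℝ) (n : ℕ) : Fin d → ℕ := fun i => ⌊2 ^ n * x i⌋₊

lemma dyadicBox_dyadicIndex_succ_subset {d : ℕ} {x : Fin d → ℝ} (hx : ∀ i, 0 ≤ x i) (n : ℕ) :
    dyadicBox d (n + 1) (dyadicIndex d x (n + 1)) ⊆ dyadicBox d n (dyadicIndex d x n) := by
  intro y hy i _
  have hyi := hy i (mem_univ i)
  simp only [dyadicIndex] at hyi ⊢
  have hxi := hx i
  have h1 := Nat.floor_le (a := 2 ^ n * x i) (by positivity)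
  have h2 := Nat.lt_floor_add_one (2 ^ n * x i)
  have h3 := Nat.floor_le (a := 2 ^ (n + 1) * x i) (by positivity)
  have h4 := Nat.lt_floor_add_one (2 ^ (n + 1) * x i)
  set a := ⌊2 ^ n * x i⌋₊
  set b := ⌊2 ^ (n + 1) * x i⌋₊
  rw [pow_succ] at h3 h4 hyi
  have hp : (0 : ℝ) < 2 ^ n := by positivity
  have hba : b < 2 * a + 2 := by
    have : (b : ℝ) < 2 * a + 2 := by linarith
    exact_mod_cast this
  have hab : 2 * a < b + 1 := by
    have : (2 : ℝ) * a < b + 1 := by linarith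
    exact_mod_cast this
  have hba' : (b : ℝ) ≤ 2 * a + 1 := by exact_mod_cast Nat.lt_succ_iff.1 hba
  have hab' : (2 : ℝ) * a ≤ b := by exact_mod_cast Nat.lt_succ_iff.1 hab
  obtain ⟨hl, hr⟩ := hyi
  rw [div_lt_iff₀ (by positivity)] at hl
  rw [lt_div_iff₀ (by positivity)] at hr
  constructor
  · rw [div_lt_iff₀ hp]; linarith
  · rw [lt_div_iff₀ hp]; linarith

lemma ae_forall_ne_dyadic (d : ℕ) :
    ∀ᵐ x : Fin d → ℝ, ∀ i : Fin d, ∀ n m : ℕ, 2 ^ n * x i ≠ m := by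
  rw [ae_all_iff]; intro i
  rw [ae_all_iff]; intro n
  rw [ae_all_iff]; intro m
  have h := Measure.ae_eval_ne (fun _ : Fin d => (volume : Measure ℝ)) i ((m : ℝ) / 2 ^ n)
  filter_upwards [h] with x hx h'
  apply hx
  rw [eq_div_iff (by positivity), mul_comm]
  exact h'

lemma mem_dyadicBox_dyadicIndex {d : ℕ} {x : Fin d → ℝ} (hx : ∀ i, 0 ≤ x i) (n : ℕ)
    (hne : ∀ i : Fin d, ∀ m : ℕ, 2 ^ n * x i ≠ m) :
    x ∈ dyadicBox d n (dyadicIndex d x n) := by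
  intro i _
  have hxi := hx i
  have hp : (0 : ℝ) < 2 ^ n := by positivity
  constructor
  · rw [div_lt_iff₀ hp, mul_comm]
    exact lt_of_le_of_ne (Nat.floor_le (by positivity)) (hne i _).symm
  · rw [lt_div_iff₀ hp, mul_comm]
    exact Nat.lt_floor_add_one _

/-- Almost every point of a set has dyadic density one. -/
lemma ae_tendsto_dyadic_density (d : ℕ) (E : Set (Fin d → ℝ)) :
    ∀ᵐ x ∂volume.restrict E, (∀ i, 0 ≤ x i) →
      Tendsto (fun n => volume (E ∩ dyadicBox d n (dyadicIndex d x n)) /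
        volume (dyadicBox d n (dyadicIndex d x n))) atTop (𝓝 1) := by
  filter_upwards [IsUnifLocDoublingMeasure.ae_tendsto_measure_inter_div
    (volume : Measure (Fin d → ℝ)) E 1] with x hx hpos
  have hlim : Tendsto (fun n : ℕ => (1 / 2 / 2 ^ n : ℝ)) atTop (𝓝[>] 0) := by
    refine tendsto_nhdsWithin_iff.2 ⟨?_, Eventually.of_forall fun n => ?_⟩
    · exact tendsto_const_nhds.div_atTop (tendsto_pow_atTop_atTop_of_one_lt one_lt_two)
    · simp only [mem_Ioi]; positivity
  have key := hx (fun n i => ((dyadicIndex d x n i : ℝ) + 1 / 2) / 2 ^ n)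
    (fun n => 1 / 2 / 2 ^ n) hlim ?_
  · refine key.congr fun n => ?_
    have h := dyadicBox_ae_eq_closedBall d n (dyadicIndex d x n)
    rw [measure_congr h, measure_congr ((ae_eq_refl E).inter h)]
  · refine Eventually.of_forall fun n => ?_
    rw [one_mul, closedBall_pi _ (by positivity)]
    intro i _
    have hp : (0 : ℝ) < 2 ^ n := by positivity
    have h1 := Nat.floor_le (mul_nonneg hp.le (hpos i))
    have h2 := Nat.lt_floor_add_one (2 ^ n * x i)
    beta_reduce
    rw [Real.closedBall_eq_Icc, ← sub_div, ← add_div, mem_Icc, div_le_iff₀ hp, le_div_iff₀ hp]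
    simp only [dyadicIndex]
    constructor <;> linarith

lemma ae_exists_dyadicBox (d : ℕ) (E : Set (Fin d → ℝ))
    (h0 : volume (E ∩ dyadicBox d 0 0) < volume (dyadicBox d 0 0) / 2) :
    ∀ᵐ x ∂volume.restrict E, x ∈ dyadicBox d 0 0 → ∃ (n : ℕ) (k : Fin d → ℕ),
      (∀ i, k i < 2 ^ n) ∧ x ∈ dyadicBox d n k ∧
      volume (dyadicBox d n k) / 2 ^ (d + 1) ≤ volume (E ∩ dyadicBox d n k) ∧
      volume (E ∩ dyadicBox d n k) < volume (dyadicBox d n k) / 2 := by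
  classical
  filter_upwards [ae_tendsto_dyadic_density d E, ae_restrict_of_ae (ae_forall_ne_dyadic d)]
    with x hx hne hx0
  have hx01 : ∀ i, 0 < x i ∧ x i < 1 := fun i => by
    simpa [dyadicBox] using hx0 i (mem_univ i)
  have hpos : ∀ i, 0 ≤ x i := fun i => (hx01 i).1.le
  have hk : ∀ n i, dyadicIndex d x n i < 2 ^ n := fun n i => by
    have hp : (0 : ℝ) < 2 ^ n := by positivity
    refine (Nat.floor_lt (mul_nonneg hp.le (hpos i))).2 ?_
    push_cast
    nlinarith [(hx01 i).2]
  have hex : ∃ n, volume (dyadicBox d n (dyadicIndex d x n)) / 2 ≤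
      volume (E ∩ dyadicBox d n (dyadicIndex d x n)) := by
    obtain ⟨n, hn⟩ := ((hx hpos).eventually
      (lt_mem_nhds (ENNReal.half_lt_self one_ne_zero ENNReal.one_ne_top))).exists
    refine ⟨n, ?_⟩
    have := ENNReal.mul_le_of_le_div hn.le
    rwa [one_div, mul_comm, ← div_eq_mul_inv] at this
  have hk0 : dyadicIndex d x 0 = 0 := by
    funext i
    simpa using hk 0 i
  have hfind := Nat.find_spec hex
  have hmin := fun m => Nat.find_min hex (m := m)
  rcases hN : Nat.find hex with _ | n
  · rw [hN, hk0] at hfind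
    exact absurd h0 hfind.not_gt
  · rw [hN] at hfind hmin
    refine ⟨n, dyadicIndex d x n, hk n, mem_dyadicBox_dyadicIndex hpos n (fun i => hne i n), ?_,
      not_le.1 (hmin n n.lt_succ_self)⟩
    calc volume (dyadicBox d n (dyadicIndex d x n)) / 2 ^ (d + 1)
        = volume (dyadicBox d (n + 1) (dyadicIndex d x (n + 1))) / 2 := by
          have e : ((1 : ℝ) / 2 ^ n) ^ d = (1 / 2 ^ (n + 1)) ^ d * 2 ^ d := by
            rw [← mul_pow]; congr 1; field_simp; ring
          rw [volume_dyadicBox, volume_dyadicBox, e, ENNReal.ofReal_mul (by positivity),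
            ENNReal.ofReal_pow two_pos.le, ENNReal.ofReal_ofNat, pow_succ 2 d,
            mul_comm, ENNReal.mul_div_mul_left _ _ (by simp) (by simp)]
      _ ≤ volume (E ∩ dyadicBox d (n + 1) (dyadicIndex d x (n + 1))) := hfind
      _ ≤ _ := measure_mono (inter_subset_inter_right _
          (dyadicBox_dyadicIndex_succ_subset hpos n))

open scoped Pointwise in
lemma volume_image_similarity (d : ℕ) {l : ℝ} (hl : 0 < l) (r : Euc d ≃ₗᵢ[ℝ] Euc d) (v : Euc d)
    (A : Set (Fin d → ℝ)) :
    volume ((fun y => l • r (WithLp.toLp 2 y) + v) '' A) = ENNReal.ofReal (l ^ d) * volume A := by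
  have h : (fun y => l • r (WithLp.toLp 2 y) + v) '' A =
      (fun y => y + v) '' (l • (r.symm ⁻¹'
        ((MeasurableEquiv.toLp 2 (Fin d → ℝ)).symm ⁻¹' A))) := by
    have h1 : ∀ S : Set (Euc d), r.symm ⁻¹' S = r '' S :=
      fun S => (r.toEquiv.image_eq_preimage_symm S).symm
    rw [h1, ← MeasurableEquiv.image_eq_preimage_symm]
    simp only [← image_smul, image_image]
    rfl
  have h2 (S : Set (Euc d)) : volume (r.symm ⁻¹' S) = volume S :=
    (r.symm.measurePreserving).measure_preimage_emb
      r.symm.toHomeomorph.measurableEmbedding S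
  rw [h, image_add_right, measure_preimage_add_right, Measure.addHaar_smul,
    finrank_euclideanSpace, Fintype.card_fin, abs_of_pos (by positivity), h2,
    (EuclideanSpace.volume_preserving_symm_measurableEquiv_toLp (Fin d)).measure_preimage_equiv]

lemma image_similarity_dyadicBox (d n : ℕ) (k : Fin d → ℕ) (l : ℝ) (r : Euc d ≃ₗᵢ[ℝ] Euc d)
    (v : Euc d) :
    (fun y => l • r (WithLp.toLp 2 y) + v) '' dyadicBox d n k = (fun x => l • r x + v) ''
      {x : Euc d | ∀ i, x i ∈ Ioo ((k i : ℝ) / 2 ^ n) (((k i : ℝ) + 1) / 2 ^ n)} := by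
  ext z
  constructor
  · rintro ⟨y, hy, rfl⟩
    exact ⟨WithLp.toLp 2 y, fun i => hy i (mem_univ i), rfl⟩
  · rintro ⟨x, hx, rfl⟩
    exact ⟨WithLp.ofLp x, fun i _ => hx i, rfl⟩

/-- if `E ⊆ Q0` is measurable with `|E ∩ Q0| < |Q0|/2`, then the dyadic
subcubes `Q ∈ Δ(Q0)` with `2^{-d-1} ≤ |E ∩ Q|/|Q| < 1/2` cover almost all of `E ∩ Q0`. -/
theorem stmt13 (d : ℕ) (hd : 1 ≤ d) (Q0 : Set (Euc d)) (hQ0 : IsCube d Q0)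
    (E : Set (Euc d)) (hE : MeasurableSet E) (hEsub : E ⊆ Q0)
    (hsmall : volume (E ∩ Q0) < volume Q0 / 2) :
    volume ((E ∩ Q0) \
      ⋃₀ {Q | IsDyadicOf d Q Q0 ∧ volume Q / 2 ^ (d+1) ≤ volume (E ∩ Q) ∧
        volume (E ∩ Q) < volume Q / 2}) = 0 := by
  obtain ⟨l, hl, r, v, hQ⟩ := hQ0
  set g : (Fin d → ℝ) → Euc d := fun y => l • r (WithLp.toLp 2 y) + v with hg
  have hvol : ∀ A, volume (g '' A) = ENNReal.ofReal (l ^ d) * volume A :=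
    volume_image_similarity d hl r v
  have hc0 : ENNReal.ofReal (l ^ d) ≠ 0 := by
    simpa using pow_pos hl d
  have hct : ENNReal.ofReal (l ^ d) ≠ ⊤ := ENNReal.ofReal_ne_top
  have hinter : ∀ A, volume (E ∩ g '' A) = ENNReal.ofReal (l ^ d) * volume (g ⁻¹' E ∩ A) := by
    intro A
    rw [← hvol, image_preimage_inter]
  have hQ0 : Q0 = g '' dyadicBox d 0 0 := by
    rw [hQ, image_similarity_dyadicBox]
    simp
  have hgm : Measurable g := by
    have : Continuous g := by
      have := PiLp.continuous_toLp 2 (fun _ : Fin d => ℝ)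
      have := r.continuous
      fun_prop
    exact this.measurable
  have hlt : ∀ A, volume (E ∩ g '' A) < volume (g '' A) / 2 ↔
      volume (g ⁻¹' E ∩ A) < volume A / 2 := fun A => by
    rw [hinter, hvol, mul_div_assoc, ENNReal.mul_lt_mul_iff_right hc0 hct]
  have hae := ae_exists_dyadicBox d (g ⁻¹' E) ((hlt _).1 (hQ0 ▸ hsmall))
  rw [ae_restrict_iff' (hgm hE)] at hae
  set U := ⋃₀ {Q | IsDyadicOf d Q Q0 ∧ volume Q / 2 ^ (d+1) ≤ volume (E ∩ Q) ∧
        volume (E ∩ Q) < volume Q / 2} with hU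
  have hnull : volume ((g ⁻¹' E ∩ dyadicBox d 0 0) \ g ⁻¹' U) = 0 := by
    refine measure_mono_null ?_ (ae_iff.1 hae)
    rintro y ⟨⟨hyE, hy0⟩, hyU⟩ hy
    obtain ⟨n, k, hk, hyk, hge, hlt'⟩ := hy hyE hy0
    refine hyU ⟨g '' dyadicBox d n k, ⟨⟨l, r, v, hl, hQ, n, k, hk,
      image_similarity_dyadicBox d n k l r v⟩, ?_, (hlt _).2 hlt'⟩, mem_image_of_mem g hyk⟩
    rw [hinter, hvol, mul_div_assoc]
    gcongr
  have hsub : (E ∩ Q0) \ U ⊆ g '' ((g ⁻¹' E ∩ dyadicBox d 0 0) \ g ⁻¹' U) := by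
    rintro z ⟨⟨hzE, hz0⟩, hzU⟩
    rw [hQ0] at hz0
    obtain ⟨y, hy, rfl⟩ := hz0
    exact ⟨y, ⟨⟨hzE, hy⟩, hzU⟩, rfl⟩
  refine measure_mono_null hsub ?_
  rw [hvol, hnull, mul_zero]
end
end
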